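/- Let k be a positive integer. If (G, x, y) is a 2-connected rooted graph of minimum degree at least k+1, then there exist k admissible paths between x and y in G. -/

import Mathlib

/-- A finite graph is 2-connected: it has at least 3 vertices and remains connected after
deleting any single vertex. -/
def TwoConnected {V : Type*} [Fintype V] (G : SimpleGraph V) : Prop :=
  3 ≤ Fintype.card V ∧ ∀ v : V, (G.induce ({v}ᶜ : Set V)).Connected

namespace Adm
noncomputable section
open Classical Finset

variable {V : Type*}

inductive Pth (G : SimpleGraph V) : Finset V → V → V → ℕ → Prop
  | nil {W : Finset V} {a : V} : a ∈ W → Pth G W a a 0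
  | cons {W : Finset V} {a b c : V} {n : ℕ} : a ∈ W → G.Adj a c → Pth G (W.erase a) c b n →
      Pth G W a b (n + 1)

theorem Pth.fst {G : SimpleGraph V} {W a b n} (h : Pth G W a b n) : a ∈ W := by
  cases h <;> assumption

theorem Pth.snd {G : SimpleGraph V} {W a b n} (h : Pth G W a b n) : b ∈ W := by
  induction h with
  | nil h => exact h
  | cons h1 h2 h3 ih => exact (mem_erase.1 ih).2

theorem Pth.mono' {G H : SimpleGraph V} {W a b n} (h : Pth G W a b n) :
    ∀ {W' : Finset V}, W ⊆ W' → (∀ u ∈ W, ∀ v ∈ W, G.Adj u v → H.Adj u v) → Pth H W' a b n := by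
  induction h with
  | nil h => intro W' hs _; exact .nil (hs h)
  | cons h1 h2 h3 ih =>
    intro W' hs hG
    refine .cons (hs h1) (hG _ h1 _ (mem_erase.1 h3.fst).2 h2) (ih (erase_subset_erase _ hs) ?_)
    intro u hu v hv
    exact hG u (mem_erase.1 hu).2 v (mem_erase.1 hv).2

theorem Pth.mono {G : SimpleGraph V} {W W' a b n} (h : Pth G W a b n) (hs : W ⊆ W') :
    Pth G W' a b n := h.mono' hs (fun _ _ _ _ h => h)

theorem Pth.append {G : SimpleGraph V} {W a b n} (h : Pth G W a b n) :
    ∀ {W' X : Finset V} {c m}, Pth G W' b c m → W ∩ W' ⊆ {b} → W ⊆ X → W' ⊆ X →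
      Pth G X a c (n + m) := by
  induction h with
  | nil h => intro W' X c m h' _ _ h2; simpa using h'.mono h2
  | @cons W a b c n h1 h2 h3 ih =>
    intro W' X d m h' hd hs hs'
    have hb := mem_erase.1 h3.snd
    have ha : a ∉ W' := by
      intro ha
      have := hd (mem_inter.2 ⟨h1, ha⟩)
      exact hb.1 (mem_singleton.1 this).symm
    have : Pth G (X.erase a) c d (n + m) := by
      apply ih h'
      · intro u hu; apply hd; simp at hu ⊢; tauto
      · exact erase_subset_erase _ hs
      · intro u hu; refine mem_erase.2 ⟨?_, hs' hu⟩; rintro rfl; exact ha hu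
    have := Pth.cons (hs h1) h2 this
    rwa [show n + 1 + m = n + m + 1 by omega]

theorem Pth.edge {G : SimpleGraph V} {W : Finset V} {a b : V} (h : G.Adj a b) (ha : a ∈ W)
    (hb : b ∈ W) : Pth G W a b 1 :=
  .cons ha h (.nil (mem_erase.2 ⟨h.ne', hb⟩))

theorem Pth.snoc {G : SimpleGraph V} {W X : Finset V} {a b c : V} {n} (h : Pth G W a b n)
    (hc : G.Adj b c) (hcW : c ∉ W) (hs : W ⊆ X) (hcX : c ∈ X) : Pth G X a c (n + 1) := by
  refine h.append (W' := {b, c}) (Pth.edge hc (by simp) (by simp)) ?_ hs ?_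
  · intro u; simp; rintro h1 (h2 | rfl)
    · exact h2
    · exact absurd h1 hcW
  · intro u; simp; rintro (rfl | rfl)
    · exact hs h.snd
    · exact hcX

theorem Pth.symm {G : SimpleGraph V} {W a b n} (h : Pth G W a b n) : Pth G W b a n := by
  induction h with
  | nil h => exact .nil h
  | cons h1 h2 h3 ih => exact ih.snoc h2.symm (by simp) (erase_subset _ _) h1

theorem Pth.extend {G : SimpleGraph V} {W a b n} (h : Pth G W a b n) :
    ∀ {c}, c ∈ W → G.Adj b c → ∃ m, Pth G W a c m := by
  induction h with
  | @nil W a h => intro c hc hbc; exact ⟨1, Pth.edge hbc h hc⟩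
  | @cons W a b e n h1 h2 h3 ih =>
    intro c hc hbc
    by_cases hca : c = a
    · subst hca; exact ⟨0, .nil h1⟩
    · obtain ⟨m, hm⟩ := ih (mem_erase.2 ⟨hca, hc⟩) hbc
      exact ⟨m + 1, .cons h1 h2 hm⟩

/-- Connectedness of a set of vertices, in terms of closed subsets. -/
def Conn (G : SimpleGraph V) (C : Finset V) : Prop :=
  ∀ D ⊆ C, D.Nonempty → (∀ u ∈ D, ∀ v ∈ C, G.Adj u v → v ∈ D) → C ⊆ D

theorem Pth.closed {G : SimpleGraph V} {W a b n} (h : Pth G W a b n) {D : Finset V}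
    (hD : ∀ u ∈ D, ∀ v ∈ W, G.Adj u v → v ∈ D) (ha : a ∈ D) : b ∈ D := by
  induction h with
  | nil h => exact ha
  | cons h1 h2 h3 ih =>
    have := (mem_erase.1 h3.fst).2
    exact ih (fun u hu v hv => hD u hu v (mem_erase.1 hv).2) (hD _ ha _ this h2)

theorem exists_comp (G : SimpleGraph V) {W : Finset V} {a : V} (ha : a ∈ W) :
    ∃ C ⊆ W, a ∈ C ∧ (∀ u ∈ C, ∀ v ∈ W, G.Adj u v → v ∈ C) ∧ Conn G C := by
  let C := W.filter (fun b => ∃ n, Pth G W a b n)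
  have hC : ∀ u ∈ C, ∀ v ∈ W, G.Adj u v → v ∈ C := by
    intro u hu v hv huv
    obtain ⟨_, n, hn⟩ := mem_filter.1 hu
    exact mem_filter.2 ⟨hv, hn.extend hv huv⟩
  refine ⟨C, filter_subset _ _, mem_filter.2 ⟨ha, 0, .nil ha⟩, hC, ?_⟩
  intro D hDC hne hD
  have hD' : ∀ u ∈ D, ∀ v ∈ W, G.Adj u v → v ∈ D :=
    fun u hu v hv h => hD u hu v (hC u (hDC hu) v hv h) h
  by_cases haD : a ∈ D
  · intro u hu
    obtain ⟨_, n, hn⟩ := mem_filter.1 hu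
    exact hn.closed hD' haD
  · obtain ⟨d, hd⟩ := hne
    obtain ⟨_, n, hn⟩ := mem_filter.1 (hDC hd)
    exact absurd (hn.symm.closed hD' hd) haD

theorem Conn.path {G : SimpleGraph V} {C : Finset V} (h : Conn G C) {a b : V} (ha : a ∈ C)
    (hb : b ∈ C) : ∃ n, Pth G C a b n := by
  obtain ⟨D, hD, haD, hcl, -⟩ := exists_comp G ha
  let D' := C.filter (fun b => ∃ n, Pth G C a b n)
  have : C ⊆ D' := by
    apply h D' (filter_subset _ _) ⟨a, mem_filter.2 ⟨ha, 0, .nil ha⟩⟩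
    intro u hu v hv huv
    obtain ⟨_, n, hn⟩ := mem_filter.1 hu
    exact mem_filter.2 ⟨hv, hn.extend hv huv⟩
  exact (mem_filter.1 (this hb)).2

/-- arithmetic progressions with difference one or two -/
def LAP (P : ℕ → Prop) (k : ℕ) : Prop :=
  ∃ l d : ℕ, (d = 1 ∨ d = 2) ∧ ∀ i < k, P (l + d * i)

theorem LAP.mono {P Q : ℕ → Prop} {k j : ℕ} (h : LAP P k) (hj : j ≤ k) (c : ℕ)
    (hPQ : ∀ n, P n → Q (n + c)) : LAP Q j := by
  obtain ⟨l, d, hd, h⟩ := h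
  refine ⟨l + c, d, hd, fun i hi => ?_⟩
  have := hPQ _ (h i (by omega))
  rwa [show l + c + d * i = l + d * i + c by omega]

theorem LAP.add {P Q R : ℕ → Prop} {k₁ k₂ k : ℕ} (h₁ : LAP P k₁) (h₂ : LAP Q k₂)
    (hk₁ : 1 ≤ k₁) (hk₂ : 1 ≤ k₂) (hk : k + 1 ≤ k₁ + k₂)
    (hR : ∀ m n, P m → Q n → R (m + n)) : LAP R k := by
  obtain ⟨l₁, d₁, hd₁, h₁⟩ := h₁
  obtain ⟨l₂, d₂, hd₂, h₂⟩ := h₂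
  have key : ∃ d, (d = 1 ∨ d = 2) ∧ ∀ i < k, ∃ i₁ < k₁, ∃ i₂ < k₂, d₁ * i₁ + d₂ * i₂ = d * i := by
    by_cases hdd : d₁ = d₂
    · refine ⟨d₁, hd₁, fun i hi => ⟨min i (k₁ - 1), by omega, i - min i (k₁ - 1), by omega, ?_⟩⟩
      subst hdd
      rw [← Nat.mul_add]; congr 1; omega
    · by_cases h1 : k₁ = 1
      · exact ⟨d₂, hd₂, fun i hi => ⟨0, by omega, i, by omega, by simp⟩⟩
      by_cases h2 : k₂ = 1
      · exact ⟨d₁, hd₁, fun i hi => ⟨i, by omega, 0, by omega, by simp⟩⟩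
      refine ⟨1, Or.inl rfl, fun i hi => ?_⟩
      rcases hd₁ with rfl | rfl <;> rcases hd₂ with rfl | rfl
      · omega
      · by_cases hi2 : i / 2 < k₂
        · exact ⟨i % 2, by omega, i / 2, hi2, by omega⟩
        · exact ⟨i - 2 * (k₂ - 1), by omega, k₂ - 1, by omega, by omega⟩
      · by_cases hi2 : i / 2 < k₁
        · exact ⟨i / 2, hi2, i % 2, by omega, by omega⟩
        · exact ⟨k₁ - 1, by omega, i - 2 * (k₁ - 1), by omega, by omega⟩
      · omega
  obtain ⟨d, hd, key⟩ := key
  refine ⟨l₁ + l₂, d, hd, fun i hi => ?_⟩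
  obtain ⟨i₁, hi₁, i₂, hi₂, he⟩ := key i hi
  have := hR _ _ (h₁ i₁ hi₁) (h₂ i₂ hi₂)
  rwa [show l₁ + d₁ * i₁ + (l₂ + d₂ * i₂) = l₁ + l₂ + d * i by omega] at this

/-- neighbours of `v` in `W` -/
def nb (G : SimpleGraph V) (W : Finset V) (v : V) : Finset V := W.filter (fun u => G.Adj v u)

theorem mem_nb {G : SimpleGraph V} {W : Finset V} {v u : V} :
    u ∈ nb G W v ↔ u ∈ W ∧ G.Adj v u := by simp [nb]

/-- rooted 2-connectedness of the graph induced on `W` -/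
structure TC (G : SimpleGraph V) (W : Finset V) (x y : V) : Prop where
  hx : x ∈ W
  hy : y ∈ W
  hne : x ≠ y
  hex : ∃ v ∈ W, v ≠ x ∧ v ≠ y
  h : ∀ D ⊆ W, D.Nonempty → x ∉ D → y ∉ D → ∀ p, ∃ u ∈ W, u ∉ D ∧ u ≠ p ∧ ∃ v ∈ D, G.Adj v u

theorem TC.symm {G : SimpleGraph V} {W x y} (h : TC G W x y) : TC G W y x :=
  ⟨h.hy, h.hx, h.hne.symm, by obtain ⟨v, h1, h2, h3⟩ := h.hex; exact ⟨v, h1, h3, h2⟩,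
    fun D hD hn h1 h2 p => h.h D hD hn h2 h1 p⟩

theorem TC.path {G : SimpleGraph V} {W x y} (h : TC G W x y) : ∃ n, Pth G W x y n := by
  by_contra hcon
  obtain ⟨C, hC, hxC, hcl, hconn⟩ := exists_comp G h.hx
  have hyC : y ∉ C := by
    intro hy
    obtain ⟨n, hn⟩ := hconn.path hxC hy
    exact hcon ⟨n, hn.mono hC⟩
  by_cases h1 : ∃ v ∈ C, v ≠ x
  · obtain ⟨v, hv, hvx⟩ := h1
    obtain ⟨u, hu, huD, hux, w, hw, hwu⟩ := h.h (C.erase x) ((erase_subset _ _).trans hC)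
      ⟨v, by simp [*]⟩ (by simp) (by simp [hyC]) x
    grind
  · obtain ⟨v, hv, hvx, hvy⟩ := h.hex
    obtain ⟨u, hu, huD, hux, w, hw, hwu⟩ := h.h ((W.erase x).erase y)
      (by grind) ⟨v, by simp [*]⟩ (by simp) (by simp) y
    have : u = x := by grind
    subst this
    have := hcl _ hxC w (by grind) hwu.symm
    grind

end
end Adm

namespace Adm
noncomputable section
open Classical Finset
variable {V : Type*}

theorem Conn.drop {G : SimpleGraph V} {X : Finset V} (h : Conn G X) {v y : V} (hv : v ∈ X)
    (hy : y ∈ X) (hvy : v ≠ y) :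
    ∃ B ⊆ X.erase v, y ∈ B ∧ Conn G B ∧ ∃ b ∈ B, G.Adj b v := by
  obtain ⟨n, hn⟩ := h.path hv hy
  cases hn with
  | nil h => exact absurd rfl hvy
  | @cons _ _ _ c n h1 h2 h3 =>
    obtain ⟨B, hB, hyB, hcl, hcB⟩ := exists_comp G h3.snd
    exact ⟨B, hB, hyB, hcB, c, h3.symm.closed hcl hyB, h2.symm⟩

theorem Conn.union {G : SimpleGraph V} {X Y : Finset V} (hX : Conn G X) (hY : Conn G Y)
    {a b : V} (ha : a ∈ X) (hb : b ∈ Y) (hab : G.Adj a b) : Conn G (X ∪ Y) := by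
  have key : ∀ {X Y : Finset V}, Conn G X → Conn G Y → ∀ {a b : V}, a ∈ X → b ∈ Y → G.Adj a b →
      ∀ D ⊆ X ∪ Y, (∀ u ∈ D, ∀ v ∈ X ∪ Y, G.Adj u v → v ∈ D) → (∃ d ∈ D, d ∈ X) → X ∪ Y ⊆ D := by
    intro X Y hX hY a b ha hb hab D hD hcl ⟨d, hdD, hdX⟩
    have h1 : X ⊆ D ∩ X := hX (D ∩ X) inter_subset_right ⟨d, by simp [*]⟩ (by grind)
    have hbD : b ∈ D := hcl a (by grind) b (by grind) hab
    have h2 : Y ⊆ D ∩ Y := hY (D ∩ Y) inter_subset_right ⟨b, by simp [*]⟩ (by grind)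
    grind
  intro D hD ⟨d, hd⟩ hcl
  rcases mem_union.1 (hD hd) with h | h
  · exact key hX hY ha hb hab D hD hcl ⟨d, hd, h⟩
  · rw [union_comm] at hD hcl ⊢
    exact key hY hX hb ha hab.symm D hD hcl ⟨d, hd, h⟩

theorem Conn.single (G : SimpleGraph V) (a : V) : Conn G {a} := by
  intro D hD ⟨d, hd⟩ _
  grind

def Thru (G : SimpleGraph V) (W : Finset V) (x y v : V) : Prop :=
  ∃ A ⊆ W, ∃ B ⊆ W, (∀ u ∈ A, u ∉ B) ∧ x ∈ A ∧ y ∈ B ∧ v ∉ A ∧ v ∉ B ∧ Conn G A ∧ Conn G B ∧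
    (∃ a ∈ A, G.Adj a v) ∧ (∃ b ∈ B, G.Adj b v)

theorem Thru.symm {G : SimpleGraph V} {W x y v} (h : Thru G W x y v) : Thru G W y x v := by
  obtain ⟨A, hA, B, hB, h1, h2, h3, h4, h5, h6, h7, h8, h9⟩ := h
  exact ⟨B, hB, A, hA, fun u hu hv => h1 u hv hu, h3, h2, h5, h4, h7, h6, h9, h8⟩

theorem thru_step {G : SimpleGraph V} {W A B : Finset V} {x y u v : V} (hA : A ⊆ W) (hB : B ⊆ W)
    (hd : ∀ u ∈ A, u ∉ B) (hx : x ∈ A) (hy : y ∈ B) (hv : v ∈ A) (hvx : v ≠ x) (hu : u ∈ W)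
    (huA : u ∉ A) (hcA : Conn G A) (hcB : Conn G B) (huB : ∃ b ∈ B, G.Adj b u) (huv : G.Adj u v) :
    Thru G W x y v := by
  obtain ⟨A', hA', hxA', hcA', a, ha, hav⟩ := hcA.drop hv hx hvx
  obtain ⟨b, hb, hbu⟩ := huB
  have := hcB.union (Conn.single G u) hb (by simp) hbu
  refine ⟨A', by grind, B ∪ {u}, by grind, by grind, hxA', by grind, by grind, by grind, hcA', this,
    ⟨a, ha, hav⟩, u, by simp, huv⟩

theorem TC.through {G : SimpleGraph V} {W x y} (h : TC G W x y) {v : V} (hv : v ∈ W)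
    (hvx : v ≠ x) (hvy : v ≠ y) : Thru G W x y v := by
  by_contra hcon
  obtain ⟨u, hu, huD, huy, v, hvD, hvu⟩ := h.h
    (W.filter (fun v => v ≠ x ∧ v ≠ y ∧ ¬ Thru G W x y v)) (filter_subset _ _)
    ⟨v, by simp [*]⟩ (by simp) (by simp) y
  clear hcon hvx hvy hv
  simp only [mem_filter] at hvD huD
  obtain ⟨hv, hvx, hvy, hcon⟩ := hvD
  apply hcon
  have hx := h.hx
  have hy := h.hy
  have hxy := h.hne
  by_cases hux : u = x
  · subst hux
    obtain ⟨C, hC, hvC, hcl, hcC⟩ := exists_comp G (W := W.erase u) (a := v) (by grind)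
    have hyC : y ∈ C := by
      by_contra hyC
      obtain ⟨w, hw, hwC, hwu, c, hc, hcw⟩ := h.h C (by grind) ⟨v, hvC⟩ (by grind) hyC u
      grind
    obtain ⟨B, hB, hyB, hcB, b, hb, hbv⟩ := hcC.drop hvC hyC hvy
    exact ⟨{u}, by grind, B, by grind, by grind, by simp, hyB, by grind, by grind,
      Conn.single _ _, hcB, ⟨u, by simp, hvu.symm⟩, b, hb, hbv⟩
  · have hT : Thru G W x y u := by grind
    obtain ⟨A, hA, B, hB, hd, hxA, hyB, huA, huB, hcA, hcB, hA1, hB1⟩ := hT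
    by_cases hvA : v ∈ A
    · exact thru_step hA hB hd hxA hyB hvA hvx hu huA hcA hcB hB1 hvu.symm
    by_cases hvB : v ∈ B
    · exact (thru_step hB hA (by grind) hyB hxA hvB hvy hu huB hcB hcA hA1 hvu.symm).symm
    obtain ⟨R, hR, hvR, hcl, hcR⟩ := exists_comp G (W := ((W.erase u) \ A) \ B) (a := v)
      (by have := hvu.ne; grind)
    obtain ⟨w, hw, hwR, hwu, r, hr, hrw⟩ := h.h R (by grind) ⟨v, hvR⟩ (by grind) (by grind) u
    have hwAB : w ∈ A ∨ w ∈ B := by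
      by_contra hc
      exact hwR (hcl r hr w (by grind) hrw)
    rcases hwAB with hw' | hw'
    · exact thru_step (A := A ∪ R) (by grind) hB (by grind) (by grind) hyB (by grind) hvx hu
        (by grind) (hcA.union hcR hw' hr hrw.symm) hcB hB1 hvu.symm
    · exact (thru_step (A := B ∪ R) (by grind) hA (by grind) (by grind) hxA (by grind) hvy hu
        (by grind) (hcB.union hcR hw' hr hrw.symm) hcA hA1 hvu.symm).symm

theorem sep_one {G : SimpleGraph V} {W Q A B : Finset V} {x y p q : V} (hA : A ⊆ W)
    (hB : B ⊆ W) (hQ : Q ⊆ W)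
    (hd : ∀ u ∈ A, u ∉ B) (hx : x ∈ A) (hy : y ∈ B) (hcA : Conn G A) (hcB : Conn G B)
    (hAQ : ∀ u ∈ A, u ∉ Q) (hBQ : ∀ u ∈ B, u ∉ Q) (hp : p ∈ A) (hq : q ∈ B) :
    ∃ c, ∀ n, Pth G (insert p (insert q Q)) p q n → Pth G W x y (n + c) := by
  obtain ⟨n1, h1⟩ := hcA.path hx hp
  obtain ⟨n2, h2⟩ := hcB.path hq hy
  refine ⟨n1 + n2, fun n hn => ?_⟩
  have h3 := h1.append (X := A ∪ Q ∪ {q}) hn (by grind) (by grind) (by grind)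
  have h4 := h3.append (X := W) h2 (by grind) (by grind) (by grind)
  rwa [show n + (n1 + n2) = n1 + n + n2 by omega]

theorem sep_cut {G : SimpleGraph V} {W Q A : Finset V} {x p q v : V} (hA : A ⊆ W)
    (hx : x ∈ A) (hcA : Conn G A) (hxQ : x ∉ Q) (hv : v ∈ Q) (hav : ∃ a ∈ A, G.Adj a v)
    (hpq : ∀ u ∈ W, u ∉ Q → (∃ v ∈ Q, G.Adj v u) → u = p ∨ u = q) :
    ∃ A' ⊆ A, x ∈ A' ∧ Conn G A' ∧ (∀ u ∈ A', u ∉ Q) ∧ (p ∈ A' ∨ q ∈ A') := by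
  obtain ⟨C, hC, hxC, hcl, hcC⟩ := exists_comp G (W := A \ Q) (a := x) (by grind)
  refine ⟨C, by grind, hxC, hcC, by grind, ?_⟩
  by_contra hcon
  have : A ⊆ C := by
    apply hcA C (by grind) ⟨x, hxC⟩
    intro u hu w hw huw
    by_cases hwQ : w ∈ Q
    · have := hpq u (by grind) (by grind) ⟨w, hwQ, huw.symm⟩
      grind
    · exact hcl u hu w (by grind) huw
  obtain ⟨a, ha, hav⟩ := hav
  have := hpq a (by grind) (by grind) ⟨v, hv, hav.symm⟩
  grind

/-- separation of order two -/
theorem TC.sep {G : SimpleGraph V} {W Q : Finset V} {x y p q : V} (h : TC G W x y) (hQ : Q ⊆ W)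
    (hne : Q.Nonempty) (hxQ : x ∉ Q) (hyQ : y ∉ Q)
    (hpq : ∀ u ∈ W, u ∉ Q → (∃ v ∈ Q, G.Adj v u) → u = p ∨ u = q) :
    p ∈ W ∧ q ∈ W ∧ p ∉ Q ∧ q ∉ Q ∧ TC G (insert p (insert q Q)) p q ∧
    ∀ k, LAP (Pth G (insert p (insert q Q)) p q) k → LAP (Pth G W x y) k := by
  obtain ⟨u1, hu1, hu1Q, hu1p, v1, hv1, ha1⟩ := h.h Q hQ hne hxQ hyQ p
  obtain ⟨u2, hu2, hu2Q, hu2p, v2, hv2, ha2⟩ := h.h Q hQ hne hxQ hyQ q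
  have e1 : u1 = q := by have := hpq u1 hu1 hu1Q ⟨v1, hv1, ha1⟩; grind
  have e2 : u2 = p := by have := hpq u2 hu2 hu2Q ⟨v2, hv2, ha2⟩; grind
  subst e1 e2
  refine ⟨hu2, hu1, hu2Q, hu1Q, ⟨by simp, by simp, hu2p, ⟨v1, by grind⟩, ?_⟩, ?_⟩
  · intro D hD hDn h1 h2 p0
    obtain ⟨u, hu, huD, hup, v, hv, hvu⟩ := h.h D (by grind) hDn (by grind) (by grind) p0
    refine ⟨u, ?_, huD, hup, v, hv, hvu⟩
    have := hpq u hu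
    grind
  · intro k hk
    obtain ⟨A, hA, B, hB, hd, hxA, hyB, huA, huB, hcA, hcB, hA1, hB1⟩ :=
      h.through (hQ hv1) (by grind) (by grind)
    obtain ⟨A', hA', hxA', hcA', hAQ', hA''⟩ := sep_cut hA hxA hcA hxQ hv1 hA1 hpq
    obtain ⟨B', hB', hyB', hcB', hBQ', hB''⟩ := sep_cut hB hyB hcB hyQ hv1 hB1 hpq
    have : (u2 ∈ A' ∧ u1 ∈ B') ∨ (u1 ∈ A' ∧ u2 ∈ B') := by grind
    rcases this with ⟨h1, h2⟩ | ⟨h1, h2⟩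
    · obtain ⟨c, hc⟩ := sep_one (W := W) (by grind) (by grind) hQ (by grind) hxA' hyB' hcA' hcB'
        hAQ' hBQ' h1 h2
      exact hk.mono le_rfl c hc
    · obtain ⟨c, hc⟩ := sep_one (W := W) (by grind) (by grind) hQ (by grind) hxA' hyB' hcA' hcB'
        hAQ' hBQ' h1 h2
      exact hk.mono le_rfl c (fun n hn => hc n (hn.symm.mono (by grind)))

def MainFor (V : Type*) (N : ℕ) : Prop := ∀ (W : Finset V), #W < N → ∀ (G : SimpleGraph V) (x y : V)
  (k : ℕ), TC G W x y → (∀ v ∈ W, v ≠ x → v ≠ y → k + 1 ≤ #(nb G W v)) → LAP (Pth G W x y) k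

/-- merged graph -/
def mg (G : SimpleGraph V) (x : V) (M : Finset V) : SimpleGraph V where
  Adj u v := (u ≠ x ∧ v ≠ x ∧ G.Adj u v) ∨ (u = x ∧ v ≠ x ∧ ∃ m ∈ M, G.Adj m v) ∨
    (v = x ∧ u ≠ x ∧ ∃ m ∈ M, G.Adj m u)
  symm := ⟨by intro u v h; have := @G.symm; grind [SimpleGraph.adj_comm]⟩
  loopless := ⟨by intro u h; have := G.irrefl (v := u); grind⟩

def ind (G : SimpleGraph V) (M : Finset V) (v : V) : ℕ := if ∃ m ∈ M, G.Adj m v then 1 else 0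

theorem ind_of {G : SimpleGraph V} {M : Finset V} {v m : V} (hm : m ∈ M) (h : G.Adj m v) :
    ind G M v = 1 := by unfold ind; rw [if_pos ⟨m, hm, h⟩]

theorem mg_path {G : SimpleGraph V} {U R M : Finset V} {x y : V} {l n : ℕ} (hx : x ∈ U)
    (hy : y ∈ R) (hd : ∀ u ∈ U, u ∉ R) (hM : ∀ m ∈ M, Pth G U x m l)
    (h : Pth (mg G x M) (insert x R) x y n) : Pth G (U ∪ R) x y (l + n) := by
  cases h with
  | nil h => grind
  | @cons _ _ _ c n h1 h2 h3 =>
    obtain ⟨m, hm, hmc⟩ : ∃ m ∈ M, G.Adj m c := by simp only [mg] at h2; grind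
    have hp := hM m hm
    have h4 : Pth G (insert m R) m y (n + 1) := by
      refine .cons (by simp) hmc (h3.mono' ?_ ?_)
      · have := hp.snd; grind
      · intro u hu v hv huv; simp only [mg] at huv; grind
    refine hp.append h4 ?_ (by grind) ?_
    · grind
    · have := hp.snd; grind

def Piece (G : SimpleGraph V) (R M : Finset V) (y : V) (F : Finset V) (f : V) : Prop :=
  F ⊆ R ∧ F.Nonempty ∧ y ∉ F ∧ (∀ v ∈ F, ∀ m ∈ M, ¬ G.Adj m v) ∧ f ∈ R ∧ f ∉ F ∧
    ∀ u ∈ R, u ∉ F → (∃ v ∈ F, G.Adj v u) → u = f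

theorem mg_TC {G : SimpleGraph V} {R M : Finset V} {x y : V} (hx : x ∉ R) (hy : y ∈ R)
    (hex : ∃ v ∈ R, v ≠ y) (hc : Conn G R) (hp : ∀ F f, ¬ Piece G R M y F f) :
    TC (mg G x M) (insert x R) x y := by
  refine ⟨by simp, by simp [hy], by grind, by obtain ⟨v, hv, hvy⟩ := hex; exact ⟨v, by grind⟩, ?_⟩
  intro D hD hne hxD hyD p
  have hDR : D ⊆ R := by grind
  obtain ⟨f, hf, hfD, v, hv, hvf⟩ : ∃ f ∈ R, f ∉ D ∧ ∃ v ∈ D, G.Adj v f := by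
    by_contra hcon
    push Not at hcon
    have := hc D hDR hne (by grind)
    grind
  have adj : ∀ u ∈ R, ∀ v ∈ R, G.Adj u v → (mg G x M).Adj u v := by
    intro u hu v hv h; simp only [mg]; left; grind
  by_cases hfp : f = p
  swap
  · exact ⟨f, by grind, hfD, hfp, v, hv, adj _ (hDR hv) _ hf hvf⟩
  by_cases hM : ∃ v ∈ D, ∃ m ∈ M, G.Adj m v
  · obtain ⟨v, hv, m, hm, hmv⟩ := hM
    refine ⟨x, by grind, hxD, by grind, v, hv, ?_⟩
    simp only [mg]; grind
  · have := hp D f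
    simp only [Piece] at this
    push Not at this hM
    obtain ⟨u, hu, huD, ⟨w, hw, hwu⟩, huf⟩ := this hDR hne hyD (by grind) hf hfD
    exact ⟨u, by grind, huD, by grind, w, hw, adj _ (hDR hw) _ hu hwu⟩

theorem mg_deg {G : SimpleGraph V} {R M : Finset V} {x v : V} (hx : x ∉ R) (hv : v ∈ R) :
    #(nb G R v) + ind G M v ≤ #(nb (mg G x M) (insert x R) v) := by
  have h1 : nb G R v ⊆ nb (mg G x M) (insert x R) v := by
    intro u; simp only [mem_nb, mg]; grind
  unfold ind
  split_ifs with h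
  · have h2 : insert x (nb G R v) ⊆ nb (mg G x M) (insert x R) v := by
      intro u; simp only [mem_insert, mem_nb, mg]; grind
    have h3 : x ∉ nb G R v := by simp [mem_nb, hx]
    have := card_le_card h2
    rwa [card_insert_of_notMem h3] at this
  · exact card_le_card h1

theorem core {G : SimpleGraph V} {U R M : Finset V} {x y : V} {k L N : ℕ} (hx : x ∈ U)
    (hd : ∀ u ∈ U, u ∉ R) (hc : Conn G R) (hy : y ∈ R) (hex : ∃ v ∈ R, v ≠ y) (hL : 1 ≤ L)
    (hlap : LAP (fun n => ∀ m ∈ M, Pth G U x m n) L) (hmain : MainFor V N)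
    (hN : #(insert x R) < N)
    (hdeg : ∀ v ∈ R, v ≠ y → k + 2 ≤ #(nb G R v) + ind G M v + L)
    (hp : ∀ F f, ¬ Piece G R M y F f) : LAP (Pth G (U ∪ R) x y) k := by
  have htc := mg_TC (hd x hx) hy hex hc hp
  have h2 : LAP (Pth (mg G x M) (insert x R) x y) (max 1 (k + 1 - L)) := by
    by_cases h : k + 1 - L ≤ 1
    · rw [max_eq_left h]
      obtain ⟨n, hn⟩ := htc.path
      exact ⟨n, 1, .inl rfl, fun i hi => by simpa [show i = 0 by omega] using hn⟩
    · rw [max_eq_right (by omega)]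
      refine hmain _ hN _ _ _ _ htc ?_
      intro v hv hvx hvy
      have hvR : v ∈ R := by grind
      have := mg_deg (G := G) (M := M) (hd x hx) hvR
      have := hdeg v hvR hvy
      omega
  exact hlap.add h2 hL (by omega) (by omega) (fun m n h1 h2 => mg_path hx hy hd h1 h2)

theorem core2 {G : SimpleGraph V} {U R M M2 : Finset V} {x y : V} {k L L2 N : ℕ} (hx : x ∈ U)
    (hd : ∀ u ∈ U, u ∉ R) (hc : Conn G R) (hy : y ∈ R) (hex : ∃ v ∈ R, v ≠ y) (hL : 1 ≤ L)
    (hlap : LAP (fun n => ∀ m ∈ M, Pth G U x m n) L)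
    (hlap2 : LAP (fun n => ∀ m ∈ M2, Pth G U x m n) L2) (hmain : MainFor V N)
    (hN : #(insert x R) < N)
    (hdeg : ∀ v ∈ R, v ≠ y → k + 2 ≤ #(nb G R v) + ind G M v + L)
    (hp : ∀ F f, Piece G R M y F f → 1 ≤ L2 ∧ (∃ v ∈ F, ∃ m ∈ M2, G.Adj m v) ∧
      ∀ v ∈ F, k + 2 ≤ #(nb G R v) + ind G M2 v + L2) : LAP (Pth G (U ∪ R) x y) k := by
  by_cases hP : ∃ F f, Piece G R M y F f
  swap
  · push Not at hP
    exact core hx hd hc hy hex hL hlap hmain hN hdeg hP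
  obtain ⟨F, ⟨f, hF⟩, hmin⟩ := exists_minimalFor_of_wellFoundedLT
    (fun F : Finset V => ∃ f, Piece G R M y F f) (fun F => #F) hP
  obtain ⟨hL2, hFM2, hdeg2⟩ := hp F f hF
  obtain ⟨hFR, hFne, hyF, hFM, hfR, hfF, hFu⟩ := id hF
  have hconn : Conn G (insert f F) := by
    intro D hD hDne hcl
    have hfD : f ∈ D := by
      by_contra hfD
      have := hc D (by grind) hDne (by grind)
      grind
    by_contra hcon
    have hne : (F \ D).Nonempty := by
      by_contra h; rw [not_nonempty_iff_eq_empty, sdiff_eq_empty_iff_subset] at h; grind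
    have := hc (F \ D) (by grind) hne (by
      intro u hu v hv huv
      have := hFu v hv
      have := hcl v
      have := huv.symm
      grind)
    grind
  obtain ⟨C, hC, hfC, hcl, hcC⟩ := exists_comp G (W := R \ F) (a := f) (by grind)
  have hyC : y ∈ C := by
    by_contra hyC
    have := hc ((R \ F) \ C) (by grind) ⟨y, by grind⟩ (by
      intro u hu v hv huv
      have h1 := hcl v
      have h2 := huv.symm
      by_cases hvF : v ∈ F
      · have := hFu u (by grind) (by grind) ⟨v, hvF, h2⟩
        grind
      · grind)
    grind
  obtain ⟨n, hn⟩ := hcC.path hfC hyC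
  have h3 : LAP (Pth G (U ∪ insert f F) x f) k := by
    refine core hx (by grind) hconn (by simp) ?_ hL2 hlap2 hmain ?_ ?_ ?_
    · obtain ⟨v, hv⟩ := hFne; exact ⟨v, by grind⟩
    · refine lt_of_le_of_lt (card_le_card ?_) hN; grind
    · intro v hv hvf
      have hvF : v ∈ F := by grind
      have h1 := hdeg2 v hvF
      have : nb G R v ⊆ nb G (insert f F) v := by
        intro u; have := hFu u; simp only [mem_nb]; grind
      have := card_le_card this
      omega
    · intro F' f' hF'
      obtain ⟨h1, h2, h3, h4, h5, h6, h7⟩ := hF'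
      have hs : F' ⊆ F := by grind
      have hP' : Piece G R M y F' f' := by
        refine ⟨by grind, h2, by grind, by grind, by grind, h6, ?_⟩
        intro u hu huF hv
        apply h7 u ?_ huF hv
        have := hFu u hu
        grind
      have hle : #F ≤ #F' := hmin ⟨f', hP'⟩ (card_le_card hs)
      have := eq_of_subset_of_card_le hs hle
      subst this
      grind
  refine h3.mono le_rfl n (fun m hm => hm.append hn ?_ ?_ ?_) <;> grind

theorem card_nb_split {G : SimpleGraph V} {W U R : Finset V} {v : V}
    (h : ∀ u ∈ W, G.Adj v u → u ∈ U ∨ u ∈ R) : #(nb G W v) ≤ #(nb G U v) + #(nb G R v) := by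
  refine le_trans (card_le_card ?_) (card_union_le _ _)
  intro u; simp only [mem_union, mem_nb]; grind

theorem core3 {G : SimpleGraph V} {W U M M2 : Finset V} {x y : V} {k L L2 N : ℕ} (hU : U ⊆ W)
    (hx : x ∈ U) (hy : y ∈ W) (hyU : y ∉ U) (hMU : M ⊆ U) (hxM : x ∉ M) (hMne : M.Nonempty)
    (hL : 1 ≤ L)
    (hlap : LAP (fun n => ∀ m ∈ M, Pth G U x m n) L)
    (hlap2 : LAP (fun n => ∀ m ∈ M2, Pth G U x m n) L2) (hmain : MainFor V N) (hN : #W ≤ N)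
    (hdeg : ∀ v ∈ W, v ∉ U → v ≠ y → k + 1 ≤ #(nb G W v))
    (hloss : ∀ v ∈ W, v ∉ U → v ≠ y → #(nb G U v) + 1 ≤ ind G M v + L)
    (hyu : ∃ u ∈ W, u ∉ U ∧ G.Adj y u)
    (hp : ∀ F f, F ⊆ W → F.Nonempty → (∀ v ∈ F, v ∉ U) → y ∉ F → (∀ v ∈ F, ∀ m ∈ M, ¬ G.Adj m v) →
      f ∈ W → f ∉ U → f ∉ F →
      (∀ u ∈ W, u ∉ F → (∃ v ∈ F, G.Adj v u) → u = f ∨ (u ∈ U ∧ u ∉ M)) →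
      1 ≤ L2 ∧ (∃ v ∈ F, ∃ m ∈ M2, G.Adj m v) ∧
      ∀ v ∈ F, #(nb G U v) + 1 ≤ ind G M2 v + L2) : LAP (Pth G W x y) k := by
  obtain ⟨R, hR, hyR, hcl, hcR⟩ := exists_comp G (W := W \ U) (a := y) (by grind)
  obtain ⟨u, hu, huU, hyu⟩ := hyu
  obtain ⟨m0, hm0⟩ := hMne
  have hloss' : ∀ v ∈ R, #(nb G W v) ≤ #(nb G U v) + #(nb G R v) := by
    intro v hv
    apply card_nb_split
    intro u hu huv
    have := hcl v hv u
    grind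
  refine (core2 (k := k) (U := U) (R := R) hx (by grind) hcR hyR
    ⟨u, hcl y hyR u (by grind) hyu, hyu.ne'⟩ hL hlap hlap2 hmain ?_ ?_ ?_).mono le_rfl 0
      (fun n hn => hn.mono (by grind))
  · refine lt_of_lt_of_le (card_lt_card (t := W) ?_) hN
    refine ⟨by grind, ?_⟩
    intro hs
    have := hs (hU (hMU hm0))
    grind
  · intro v hv hvy
    have := hdeg v (by grind) (by grind) hvy
    have := hloss v (by grind) (by grind) hvy
    have := hloss' v hv
    omega
  · intro F f ⟨h1, h2, h3, h4, h5, h6, h7⟩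
    obtain ⟨a1, a2, a3⟩ := hp F f (by grind) h2 (by grind) h3 h4 (by grind) (by grind) h6 (by
      intro u hu huF ⟨v, hv, hvu⟩
      by_cases huU : u ∈ U
      · right; refine ⟨huU, fun hm => h4 v hv u hm hvu.symm⟩
      · left; exact h7 u (hcl v (h1 hv) u (by grind) hvu) huF ⟨v, hv, hvu⟩)
    refine ⟨a1, a2, ?_⟩
    intro v hv
    have := a3 v hv
    have := hloss' v (h1 hv)
    have := hdeg v (by grind) (by grind) (by grind)
    omega

end
end Adm

namespace Adm
noncomputable section
open Classical Finset
variable {V : Type*}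

theorem clique_path {G : SimpleGraph V} : ∀ (n : ℕ) {K : Finset V} {x m : V},
    (∀ u ∈ K, ∀ v ∈ K, u ≠ v → G.Adj u v) → x ∈ K → m ∈ K → x ≠ m → n + 2 ≤ #K →
    Pth G K x m (n + 1) := by
  intro n
  induction n with
  | zero => intro K x m hK hx hm hxm _; exact Pth.edge (hK x hx m hm hxm) hx hm
  | succ n ih =>
    intro K x m hK hx hm hxm hc
    obtain ⟨c, hc1, hc2⟩ : ∃ c ∈ K.erase x, c ≠ m := by
      apply exists_mem_ne
      rw [card_erase_of_mem hx]; omega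
    refine .cons hx (hK x hx c (by grind) (by grind)) (ih (by grind) hc1 (by grind) hc2 ?_)
    rw [card_erase_of_mem hx]; omega

theorem bip_path {G : SimpleGraph V} : ∀ (i : ℕ) {S T : Finset V} {x t : V},
    (∀ s ∈ S, ∀ t ∈ T, G.Adj s t) → (∀ s ∈ S, s ∉ T) → x ∈ S → t ∈ T → i < #S → i < #T →
    Pth G (S ∪ T) x t (1 + 2 * i) := by
  intro i
  induction i with
  | zero => intro S T x t h hd hx ht _ _; exact Pth.edge (h x hx t ht) (by grind) (by grind)
  | succ i ih =>
    intro S T x t h hd hx ht hS hT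
    obtain ⟨s', hs', hs'x⟩ : ∃ s ∈ S, s ≠ x := exists_mem_ne (by omega) _
    obtain ⟨t', ht', ht't⟩ : ∃ s ∈ T, s ≠ t := exists_mem_ne (by omega) _
    have h1 : Pth G (S.erase x ∪ T.erase t') s' t (1 + 2 * i) := by
      apply ih
      · grind
      · grind
      · grind
      · grind
      · rw [card_erase_of_mem hx]; omega
      · rw [card_erase_of_mem ht']; omega
    clear ih
    have h2 : Pth G ((S ∪ T).erase x) t' t (1 + 2 * i + 1) :=
      .cons (by grind) (h s' hs' t' ht').symm (h1.mono (by grind))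
    exact .cons (by grind) (h x hx t' ht') h2

theorem bip_path' {G : SimpleGraph V} (i : ℕ) {S T : Finset V} {x a : V}
    (h : ∀ s ∈ S, ∀ t ∈ T, G.Adj s t) (hd : ∀ s ∈ S, s ∉ T) (hx : x ∈ S) (ha : a ∈ S) (hxa : x ≠ a)
    (hS : i + 1 < #S) (hT : i < #T) : Pth G (S ∪ T) x a (2 + 2 * i) := by
  obtain ⟨t, ht⟩ : T.Nonempty := card_pos.1 (by omega)
  have h1 : Pth G (T ∪ S.erase x) t a (1 + 2 * i) := by
    apply bip_path
    · intro s hs t ht; exact (h t (by grind) s hs).symm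
    · grind
    · exact ht
    · grind
    · exact hT
    · rw [card_erase_of_mem hx]; omega
  rw [show 2 + 2 * i = 1 + 2 * i + 1 by omega]
  exact .cons (by grind) (h x hx t ht) (h1.mono (by grind))

/-- delete an edge -/
def del (G : SimpleGraph V) (x y : V) : SimpleGraph V where
  Adj u v := G.Adj u v ∧ ¬ (u = x ∧ v = y) ∧ ¬ (u = y ∧ v = x)
  symm := ⟨by intro u v h; exact ⟨h.1.symm, fun h' => h.2.2 ⟨h'.2, h'.1⟩, fun h' => h.2.1 ⟨h'.2, h'.1⟩⟩⟩
  loopless := ⟨by intro u h; exact G.irrefl h.1⟩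

theorem del_adj {G : SimpleGraph V} {x y v u : V} (hx : v ≠ x) (hy : v ≠ y) :
    (del G x y).Adj v u ↔ G.Adj v u := by simp [del]; tauto

theorem TC.del {G : SimpleGraph V} {W x y} (h : TC G W x y) : TC (del G x y) W x y := by
  refine ⟨h.hx, h.hy, h.hne, h.hex, ?_⟩
  intro D hD hne hx hy p
  obtain ⟨u, h1, h2, h3, v, h4, h5⟩ := h.h D hD hne hx hy p
  exact ⟨u, h1, h2, h3, v, h4, (del_adj (by grind) (by grind)).2 h5⟩

theorem nb_del {G : SimpleGraph V} {W : Finset V} {x y v} (hx : v ≠ x) (hy : v ≠ y) :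
    nb (del G x y) W v = nb G W v := by
  ext u; simp only [mem_nb, del_adj hx hy]

theorem not_del (G : SimpleGraph V) (x y : V) : ¬ (del G x y).Adj x y := by simp [del]

theorem Pth.of_del {G : SimpleGraph V} {W x y a b n} (h : Pth (del G x y) W a b n) :
    Pth G W a b n := h.mono' (Subset.refl _) (fun _ _ _ _ h => h.1)

theorem join {G : SimpleGraph V} {W U C M : Finset V} {x y m c : V} {k : ℕ} (hU : U ⊆ W)
    (hC : C ⊆ W) (hd : ∀ u ∈ U, u ∉ C) (hcC : Conn G C) (hy : y ∈ C) (hm : m ∈ M) (hc : c ∈ C)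
    (hmc : G.Adj m c) (hlap : LAP (fun n => ∀ m ∈ M, Pth G U x m n) k) :
    LAP (Pth G W x y) k := by
  obtain ⟨n, hn⟩ := hcC.path hc hy
  refine hlap.mono le_rfl (n + 1) (fun j hj => ?_)
  have h1 := hj m hm
  have hmU := h1.snd
  have h2 : Pth G (insert m C) m y (n + 1) := .cons (by simp) hmc (hn.mono (by grind))
  exact h1.append h2 (by grind) hU (by grind)

theorem lap2 {P : ℕ → Prop} {l d : ℕ} (hd : d = 1 ∨ d = 2) (h1 : P l) (h2 : P (l + d)) :
    LAP P 2 := by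
  refine ⟨l, d, hd, fun i hi => ?_⟩
  rcases (by omega : i = 0 ∨ i = 1) with rfl | rfl <;> simpa

theorem card_nb_le_ind {G : SimpleGraph V} {M : Finset V} {v : V}
    (h : ∀ a ∈ M, ∀ b ∈ M, G.Adj v a → G.Adj v b → a = b) : #(nb G M v) ≤ ind G M v := by
  unfold ind
  split_ifs with hm
  · rw [card_le_one]; intro a ha b hb; rw [mem_nb] at ha hb; exact h a ha.1 b hb.1 ha.2 hb.2
  · simp only [Nat.le_zero, card_eq_zero, eq_empty_iff_forall_notMem, mem_nb]
    rintro u ⟨hu, hvu⟩; exact hm ⟨u, hu, hvu.symm⟩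

set_option maxHeartbeats 4000000 in
theorem lemma2 : ∀ (n : ℕ) (W : Finset V), #W = n → ∀ (G : SimpleGraph V) (x y z : V),
    TC G W x y → (∃ v ∈ W, v ≠ x ∧ v ≠ y ∧ v ≠ z) →
    (∀ v ∈ W, v ≠ x → v ≠ y → v ≠ z → 3 ≤ #(nb G W v)) → LAP (Pth G W x y) 2 := by
  intro n
  induction n using Nat.strong_induction_on with
  | _ n ih =>
  suffices H : ∀ (W : Finset V), #W = n → ∀ (G : SimpleGraph V) (x y z : V), ¬ G.Adj x y →
      TC G W x y → (∃ v ∈ W, v ≠ x ∧ v ≠ y ∧ v ≠ z) →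
      (∀ v ∈ W, v ≠ x → v ≠ y → v ≠ z → 3 ≤ #(nb G W v)) → LAP (Pth G W x y) 2 by
    intro W hW G x y z h hex hdeg
    refine (H W hW (del G x y) x y z (not_del _ _ _) h.del hex ?_).mono le_rfl 0
      (fun n hn => hn.of_del)
    intro v hv hx hy hz
    rw [nb_del hx hy]; exact hdeg v hv hx hy hz
  intro W hW G x y z hxy h hex hdeg
  by_contra hgoal
  have hxW := h.hx
  have hyW := h.hy
  have hne := h.hne
  have C3z : ∀ Q ⊆ W, (∃ v ∈ Q, v ≠ z) → x ∉ Q → y ∉ Q → ∀ o ∈ W, o ∉ Q → o ≠ x → o ≠ y → ∀ p q,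
      ∃ u ∈ W, u ∉ Q ∧ u ≠ p ∧ u ≠ q ∧ ∃ v ∈ Q, G.Adj v u := by
    intro Q hQ hQz hxQ hyQ o ho hoQ hox hoy p q
    by_contra hcon
    push Not at hcon
    obtain ⟨v0, hv0, hv0z⟩ := hQz
    have hb : ∀ u ∈ W, u ∉ Q → (∃ v ∈ Q, G.Adj v u) → u = p ∨ u = q := by grind
    obtain ⟨hp, hq, hpQ, hqQ, htc, hl⟩ := h.sep hQ ⟨v0, hv0⟩ hxQ hyQ hb
    apply hgoal
    apply hl
    refine ih _ ?_ _ rfl G p q z htc ⟨v0, by grind⟩ ?_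
    · rw [← hW]
      have h1 : insert o (insert x (insert y Q)) ⊆ W := by grind
      have := card_le_card h1
      rw [card_insert_of_notMem (by grind), card_insert_of_notMem (by grind),
        card_insert_of_notMem (by grind)] at this
      have h2 := card_insert_le p (insert q Q)
      have h3 := card_insert_le q Q
      omega
    · intro v hv hvp hvq hvz
      have hvQ : v ∈ Q := by grind
      refine le_trans (hdeg v (hQ hvQ) (by grind) (by grind) hvz) (card_le_card ?_)
      intro u; simp only [mem_nb]
      rintro ⟨h1, h2⟩
      have := hb u h1
      grind
  have merge : ∀ (U R M : Finset V) (y' : V), x ∈ U → (∀ u ∈ U, u ∉ R) → y' ∈ R → Conn G R →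
      (∃ v ∈ R, v ≠ y' ∧ v ≠ z) → #(insert x R) < #W → (∀ m ∈ M, Pth G U x m 1) →
      (∀ v ∈ R, v ≠ y' → v ≠ z → 3 ≤ #(nb G R v) + ind G M v) →
      (∀ F f, ¬ Piece G R M y' F f) → LAP (Pth G (U ∪ R) x y') 2 := by
    intro U R M y' hx hd hy' hc ⟨v, hv, hvy, hvz⟩ hcard hM hdeg' hp
    have htc := mg_TC (hd x hx) hy' ⟨v, hv, hvy⟩ hc hp
    refine (ih _ (hW ▸ hcard) _ rfl (mg G x M) x y' z htc ⟨v, by grind⟩ ?_).mono le_rfl 1 ?_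
    · intro v hv h1 h2 h3
      exact (hdeg' v (by grind) h2 h3).trans (mg_deg (hd x hx) (by grind))
    · intro n hn
      rw [add_comm]
      exact mg_path hx hy' hd hM hn
  clear ih
  have hy1 : ∃ u ∈ W, u ≠ z ∧ u ≠ x ∧ G.Adj y u := by
    obtain ⟨v, hv, h1, h2⟩ := h.hex
    obtain ⟨u, hu, huD, hup, v, hv, hvu⟩ := h.h ((W.erase x).erase y) (by grind) ⟨v, by grind⟩
      (by grind) (by grind) x
    by_cases hvz : v = z
    · obtain ⟨v', hv', h1, h2, h3⟩ := hex
      obtain ⟨u', hu', huD', hup', huq', v', hv', hvu'⟩ := C3z (((W.erase x).erase y).erase z) (by grind)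
        ⟨v', by grind⟩ (by grind) (by grind) z (by grind) (by grind) (by grind) (by grind) x z
      exact ⟨v', by grind, by grind, by grind, by have := hvu'.symm; grind⟩
    · exact ⟨v, by grind, hvz, by grind, by have := hvu.symm; grind⟩
  -- no triangle at x
  have htri : ∀ u ∈ W, ∀ u' ∈ W, G.Adj x u → G.Adj x u' → ¬ G.Adj u u' := by
    intro u hu u' hu' hxu hxu' huu'
    have e1 := hxu.ne
    have e2 := hxu'.ne
    have e3 := huu'.ne
    obtain ⟨C, hC, hyC, hcl, hcC⟩ := exists_comp G (W := W \ {x, u, u'}) (a := y) (by grind)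
    obtain ⟨w, hw, hwD, hwx, v, hv, hvw⟩ := h.h ((W.erase x) \ C) (by grind) ⟨u, by grind⟩
      (by grind) (by grind) x
    have hwC : w ∈ C := by grind
    have hv' : v ∈ ({u, u'} : Finset V) := by
      have := hcl w hwC v
      have := hvw.symm
      grind
    apply hgoal
    refine join (U := {x, u, u'}) (M := {u, u'}) (by grind) (by grind) (by grind) hcC hyC hv' hwC
      hvw (lap2 (l := 1) (d := 1) (.inl rfl) ?_ ?_)
    · intro m hm
      exact Pth.edge (by grind) (by simp) (by grind)
    · intro m hm
      have hc3 : #({x, u, u'} : Finset V) = 3 := by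
        rw [card_eq_three]; exact ⟨x, u, u', e1, e2, e3, rfl⟩
      refine clique_path 1 ?_ (by simp) (by grind) (by grind) (by omega)
      intro a ha b hb hab
      have := hxu.symm; have := hxu'.symm; have := huu'.symm
      grind
  have hC4 : ∀ a ∈ W, a ≠ x → a ≠ y → ∀ t1 ∈ W, ∀ t2 ∈ W, G.Adj x t1 → G.Adj x t2 → G.Adj a t1 →
      G.Adj a t2 → t1 = t2 := by
    intro a ha hax hay t1 ht1 t2 ht2 hx1 hx2 ha1 ha2
    by_contra htt
    have e1 := hx1.ne
    have e2 := hx2.ne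
    have e3 := ha1.ne
    have e4 := ha2.ne
    obtain ⟨C, hC, hyC, hcl, hcC⟩ := exists_comp G (W := W \ {x, a, t1, t2}) (a := y) (by grind)
    obtain ⟨w, hw, hwD, hwx, hwa, v, hv, hvw⟩ := C3z (((W.erase x).erase a) \ C) (by grind)
      (by by_cases t1 = z
          · exact ⟨t2, by grind⟩
          · exact ⟨t1, by grind⟩)
      (by grind) (by grind) a ha (by grind) hax hay x a
    have hwC : w ∈ C := by grind
    have hv' : v ∈ ({t1, t2} : Finset V) := by
      have := hcl w hwC v
      have := hvw.symm
      grind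
    apply hgoal
    have hb : ∀ s ∈ ({x, a} : Finset V), ∀ t ∈ ({t1, t2} : Finset V), G.Adj s t := by grind
    refine join (U := {x, a} ∪ {t1, t2}) (M := {t1, t2}) (by grind) (by grind) (by grind) hcC hyC hv' hwC
      hvw (lap2 (l := 1) (d := 2) (.inr rfl) ?_ ?_)
    · intro m hm
      exact bip_path 0 hb (by grind) (by simp) hm (by simp) (by simp)
    · intro m hm
      refine bip_path 1 hb (by grind) (by simp) hm ?_ ?_
      · rw [card_pair hax.symm]; omega
      · rw [card_pair htt]; omega
  -- general case
  set N := nb G W x with hN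
  have memN : ∀ u, u ∈ N ↔ u ∈ W ∧ G.Adj x u := fun u => mem_nb
  have hxN : x ∉ N := by simp [memN]
  have hyN : y ∉ N := by simp [memN, hxy]
  have hNne : ∃ m, m ∈ N := by
    obtain ⟨v, hv, h1, h2⟩ := h.hex
    obtain ⟨u, hu, huD, hup, v, hv, hvu⟩ := h.h ((W.erase x).erase y) (by grind) ⟨v, by grind⟩
      (by grind) (by grind) y
    refine ⟨v, (memN v).2 ⟨by grind, ?_⟩⟩
    have := hvu.symm; grind
  obtain ⟨R, hR, hyR, hcl, hcR⟩ := exists_comp G (W := W \ (insert x N)) (a := y) (by grind)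
  by_cases hA : ∃ v ∈ R, v ≠ y ∧ v ≠ z
  · apply hgoal
    refine (merge (insert x N) R N y (by simp) (by grind) hyR hcR hA ?_ ?_ ?_ ?_).mono le_rfl 0
      (fun n hn => hn.mono (by grind))
    · obtain ⟨m, hm⟩ := hNne
      refine card_lt_card ⟨by grind, fun hs => ?_⟩
      have := hs ((memN m).1 hm).1
      grind
    · intro m hm; exact Pth.edge ((memN m).1 hm).2 (by simp) (by grind)
    · intro v hv hvy hvz
      have h1 := hdeg v (by grind) (by grind) hvy hvz
      have h2 : #(nb G W v) ≤ #(nb G N v) + #(nb G R v) := by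
        apply card_nb_split
        intro u hu hvu
        have := hcl v hv u
        have := memN v
        have := hvu.symm
        grind
      have h3 : #(nb G N v) ≤ ind G N v := by
        apply card_nb_le_ind
        intro a ha b hb hva hvb
        rw [memN] at ha hb
        exact hC4 v (by grind) (by grind) hvy a ha.1 b hb.1 ha.2 hb.2 hva hvb
      omega
    · rintro F f ⟨h1, h2, h3, h4, h5, h6, h7⟩
      obtain ⟨u, hu, huF, huf, v, hv, hvu⟩ := h.h F (by grind) h2 (by grind) h3 f
      apply huf
      refine h7 u (hcl v (h1 hv) u ?_ hvu) huF ⟨v, hv, hvu⟩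
      have := memN v
      have := hvu.symm
      grind
  obtain ⟨u, huW, huz, hux, hyu⟩ := hy1
  have huy := hyu.ne'
  have huN : u ∈ N := by
    by_contra huN
    have := hcl y hyR u (by grind) hyu
    grind
  by_cases hzR : z ∈ R ∧ z ≠ y
  · obtain ⟨hzR, hzy⟩ := hzR
    have hzy' : G.Adj z y := by
      by_contra hc
      have := hcR {y} (by grind) (by simp) (by
        intro a ha b hb hab
        have := hab.symm
        have := hab.ne
        grind)
      grind
    obtain ⟨w, hw, hwz, hwy, z', hz', hzw⟩ := h.h {z} (by grind) (by simp) (by grind) (by grind) y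
    have hz'z : z' = z := by simpa using hz'
    subst hz'z
    have hwN : w ∈ N := by
      have := memN z'
      have := hzw.symm
      by_contra hwN
      have := hcl z' hzR w (by grind) hzw
      grind
    apply hgoal
    refine lap2 (l := 2) (d := 1) (.inl rfl) ?_ ?_
    · exact .cons hxW ((memN u).1 huN).2 (Pth.edge hyu.symm (by grind) (by grind))
    · refine .cons hxW ((memN w).1 hwN).2 (.cons (by grind) hzw.symm (Pth.edge hzy' ?_ ?_)) <;> grind
  have hyN' : ∀ w ∈ W, G.Adj y w → w ∈ N := by
    intro w hw hyw
    by_contra hwN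
    have := hcl y hyR w (by have := hyw.symm; grind) hyw
    have := hyw.ne
    grind
  -- R = {y}
  obtain ⟨v, hvW, hvx, hvy, huv⟩ : ∃ v ∈ W, v ≠ x ∧ v ≠ y ∧ G.Adj u v := by
    by_contra hcon
    push Not at hcon
    have h1 := hdeg u huW hux huy huz
    have h2 : nb G W u ⊆ {x, y} := by
      intro a; simp only [mem_nb]; grind
    have := card_le_card h2
    have := card_le_two (a := x) (b := y)
    omega
  have hvN : v ∉ N := by
    intro hvN
    rw [memN] at hvN huN
    exact htri u huW v hvW huN.2 hvN.2 huv
  obtain ⟨D, hD, hvD, hclD, hcD⟩ := exists_comp G (W := ((W.erase x).erase y) \ N) (a := v) (by grind)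
  have hDm : ∀ d ∈ D, d ∈ W ∧ d ≠ x ∧ d ≠ y ∧ d ∉ N := by
    intro d hd; have := hD hd; grind
  have hcR' := (Conn.single G u).union hcD (by simp) hvD huv
  by_cases hDz : ∃ v ∈ D, v ≠ z
  · obtain ⟨v', hv', hvz'⟩ := hDz
    have := merge (insert x (N.erase u)) ({u} ∪ D) (N.erase u) u (by simp) (by grind) (by simp) hcR'
      ⟨v', by grind⟩ ?_ ?_ ?_ ?_
    · apply hgoal
      refine this.mono le_rfl 1 (fun n hn => hn.snoc hyu.symm ?_ ?_ hyW) <;> grind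
    · refine card_lt_card ⟨by grind, fun hs => ?_⟩
      have := hs hyW
      grind
    · intro m hm; exact Pth.edge ((memN m).1 (by grind)).2 (by simp) (by grind)
    · intro v hv hvy hvz
      have h1 := hdeg v (by grind) (by grind) (by grind) hvz
      have h2 : #(nb G W v) ≤ #(nb G (N.erase u) v) + #(nb G ({u} ∪ D) v) := by
        apply card_nb_split
        intro w hw hvw
        have := hclD v (by grind) w
        have := memN v
        have := hyN' v
        have := hvw.symm
        grind
      have h3 : #(nb G (N.erase u) v) ≤ ind G (N.erase u) v := by
        apply card_nb_le_ind
        intro a ha b hb hva hvb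
        rw [mem_erase, memN] at ha hb
        have hvD' := hDm v (by grind)
        exact hC4 v hvD'.1 hvD'.2.1 hvD'.2.2.1 a ha.2.1 b hb.2.1 ha.2.2 hb.2.2 hva hvb
      omega
    · rintro F f ⟨h1, h2, h3, h4, h5, h6, h7⟩
      obtain ⟨w, hw, hwF, hwf, v, hv, hvw⟩ := h.h F (by grind) h2 (by grind) (by grind) f
      apply hwf
      have hvD' : v ∈ D := by grind
      have h8 := hDm v hvD'
      refine h7 w ?_ hwF ⟨v, hv, hvw⟩
      have := hclD v hvD' w
      have := memN v
      have := hyN' v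
      have := h4 v hv w
      have := hvw.symm
      clear hC4 htri merge C3z hcl hdeg h7 hclD h4
      grind
  · obtain ⟨w, hw, hwz, hwy, z', hz', hzw⟩ := h.h D (by grind) ⟨v, hvD⟩ (by grind) (by grind) u
    have e1 : z' = z := by grind
    have e2 : v = z := by grind
    subst e1 e2
    have hwN : w ∈ N := by
      have := hclD _ hvD w
      have := memN v
      have := hyN' v
      have := hzw.symm
      grind
    have hwN' := hwN
    have huN' := huN
    rw [memN] at hwN huN
    have := hC4 v hvW hvx hvy u huW w hw huN.2 hwN.2 huv.symm hzw
    grind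

end
end Adm

namespace Adm
noncomputable section
open Classical Finset
variable {V : Type*}

structure Ctx (G : SimpleGraph V) (W : Finset V) (x y : V) (k : ℕ) : Prop where
  main : MainFor V #W
  tc : TC G W x y
  nadj : ¬ G.Adj x y
  deg : ∀ v ∈ W, v ≠ x → v ≠ y → k + 1 ≤ #(nb G W v)
  hk : 3 ≤ k
  ng : ¬ LAP (Pth G W x y) k

theorem Ctx.symm {G : SimpleGraph V} {W x y k} (h : Ctx G W x y k) : Ctx G W y x k :=
  ⟨h.main, h.tc.symm, fun h' => h.nadj h'.symm, fun v hv h1 h2 => h.deg v hv h2 h1, h.hk,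
    fun h' => h.ng (h'.mono le_rfl 0 (fun _ hn => hn.symm))⟩

theorem Ctx.c3 {G : SimpleGraph V} {W : Finset V} {x y k} (h : Ctx G W x y k) : ∀ Q ⊆ W, Q.Nonempty → x ∉ Q →
    y ∉ Q → ∀ o ∈ W, o ∉ Q → o ≠ x → o ≠ y → ∀ p q,
      ∃ u ∈ W, u ∉ Q ∧ u ≠ p ∧ u ≠ q ∧ ∃ v ∈ Q, G.Adj v u := by
  intro Q hQ hQz hxQ hyQ o ho hoQ hox hoy p q
  by_contra hcon
  push Not at hcon
  obtain ⟨v0, hv0⟩ := hQz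
  have hxW := h.tc.hx
  have hyW := h.tc.hy
  have hne := h.tc.hne
  have hb : ∀ u ∈ W, u ∉ Q → (∃ v ∈ Q, G.Adj v u) → u = p ∨ u = q := by grind
  obtain ⟨hp, hq, hpQ, hqQ, htc, hl⟩ := h.tc.sep hQ ⟨v0, hv0⟩ hxQ hyQ hb
  apply h.ng
  apply hl
  refine h.main _ ?_ G p q k htc ?_
  · have h1 : insert o (insert x (insert y Q)) ⊆ W := by grind
    have := card_le_card h1
    rw [card_insert_of_notMem (by grind), card_insert_of_notMem (by grind),
      card_insert_of_notMem (by grind)] at this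
    have h2 := card_insert_le p (insert q Q)
    have h3 := card_insert_le q Q
    omega
  · intro v hv hvp hvq
    have hvQ : v ∈ Q := by grind
    refine le_trans (h.deg v (hQ hvQ) (by grind) (by grind)) (card_le_card ?_)
    intro u; simp only [mem_nb]
    rintro ⟨h1, h2⟩
    have := hb u h1
    grind

theorem card_nb_drop {G : SimpleGraph V} {W Z : Finset V} {v c : V}
    (h : ∀ u ∈ W, G.Adj v u → u ∈ Z ∨ u = c) : #(nb G W v) ≤ #(nb G Z v) + 1 := by
  have : nb G W v ⊆ insert c (nb G Z v) := by
    intro u; simp only [mem_insert, mem_nb]; grind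
  exact (card_le_card this).trans (card_insert_le _ _)

theorem Ctx.sub3 {G : SimpleGraph V} {W D : Finset V} {x y k} (h : Ctx G W x y k) (hD : D ⊆ W)
    (hDne : D.Nonempty) (hx : x ∉ D) (hy : y ∉ D) {o : V} (ho : o ∈ W) (hoD : o ∉ D) (hox : o ≠ x)
    (hoy : o ≠ y) {a b c w : V} (ha : a ∈ W) (hb : b ∈ W) (haD : a ∉ D) (hbD : b ∉ D) (hab : a ≠ b)
    (hbd : ∀ u ∈ W, u ∉ D → (∃ v ∈ D, G.Adj v u) → u = a ∨ u = b ∨ u = c) (hw : w ∈ W)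
    (hwD : w ∉ D) (hwa : w ≠ a) (hwb : w ≠ b) :
    LAP (Pth G (insert a (insert b D)) a b) (k - 1) := by
  obtain ⟨d, hd⟩ := hDne
  have hk := h.hk
  apply h.main
  · refine card_lt_card ⟨by grind, fun hs => ?_⟩
    have := hs hw
    grind
  · refine ⟨by simp, by simp, hab, ⟨d, by grind⟩, ?_⟩
    intro D' hD' hne' haD' hbD' p0
    have hs : D' ⊆ D := by grind
    obtain ⟨u, hu, huD, hup, huc, v, hv, hvu⟩ := h.c3 D' (by grind) hne' (by grind) (by grind) o ho
      (by grind) hox hoy p0 c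
    refine ⟨u, ?_, huD, hup, v, hv, hvu⟩
    have := hbd u hu
    grind
  · intro v hv hva hvb
    have hvD : v ∈ D := by grind
    have h1 := h.deg v (hD hvD) (by grind) (by grind)
    have h2 : #(nb G W v) ≤ #(nb G (insert a (insert b D)) v) + 1 := by
      apply card_nb_drop (c := c)
      intro u hu hvu
      have := hbd u hu
      grind
    omega

theorem Ctx.r2B {G : SimpleGraph V} {W D : Finset V} {x y k} (h : Ctx G W x y k) (hD : D ⊆ W)
    (hDne : D.Nonempty) (hx : x ∉ D) (hy : y ∉ D) {a o : V} (ho : o ∈ W) (hoD : o ∉ D) (hox : o ≠ x)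
    (hoy : o ≠ y) (hoa : o ≠ a)
    (hbd : ∀ u ∈ W, u ∉ D → (∃ v ∈ D, G.Adj v u) → u = x ∨ u = a ∨ u = y) : False := by
  have hxW := h.tc.hx
  have hyW := h.tc.hy
  have hxy := h.tc.hne
  have hk := h.hk
  obtain ⟨a', ha', haD, hax, hay, v, hv, hva⟩ := h.c3 D hD hDne hx hy o ho hoD hox hoy x y
  have : a' = a := by have := hbd a' ha' haD ⟨v, hv, hva⟩; grind
  subst this
  have h1 := h.sub3 hD hDne hx hy ho hoD hox hoy (a := a') (b := y) (c := x) (w := x) ha' hyW haD hy hay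
    (by grind) hxW hx hax.symm hxy
  have h2 := h.sub3 (D := (((W \ D).erase x).erase a').erase y) (by grind) ⟨o, by grind⟩
    (by grind) (by grind) (o := a') ha' (by grind) hax hay
    (a := x) (b := a') (c := y) (w := y) hxW ha' (by grind) (by grind) hax.symm ?_ hyW (by grind) hxy.symm
    hay.symm
  · apply h.ng
    refine h2.add h1 (by omega) (by omega) (by omega) (fun m n hm hn => hm.append hn ?_ ?_ ?_) <;>
    grind
  · rintro u hu huR ⟨w, hw, hwu⟩
    have := hbd w
    have := hwu.symm
    grind

set_option maxHeartbeats 4000000 in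
theorem Ctx.r2 {G : SimpleGraph V} {W : Finset V} {x y k} (h : Ctx G W x y k) :
    ∀ (n : ℕ) (D : Finset V) (p q o : V), #W - #D = n → D ⊆ W → D.Nonempty → x ∉ D → y ∉ D →
    o ∈ W → o ∉ D → o ≠ x → o ≠ y → o ≠ p → o ≠ q →
    (∀ u ∈ W, u ∉ D → (∃ v ∈ D, G.Adj v u) → u = x ∨ u = p ∨ u = q) → False := by
  intro n
  induction n using Nat.strong_induction_on with
  | _ n ih =>
  intro D p q o hn hD hDne hx hy ho hoD hox hoy hop hoq hbd
  have hxW := h.tc.hx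
  have hyW := h.tc.hy
  have hxy := h.tc.hne
  have hk := h.hk
  have c3 := h.c3
  obtain ⟨q', hq, hqD, hqx, hqp, vq, hvq, hvq'⟩ := c3 D hD hDne hx hy o ho hoD hox hoy x p
  have : q' = q := by have := hbd q' hq hqD ⟨vq, hvq, hvq'⟩; grind
  subst this
  obtain ⟨p', hp, hpD, hpx, hpq, vp, hvp, hvp'⟩ := c3 D hD hDne hx hy o ho hoD hox hoy x q'
  have : p' = p := by have := hbd p' hp hpD ⟨vp, hvp, hvp'⟩; grind
  subst this
  rename' q' => q, p' => p
  by_cases hpy : p = y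
  · subst hpy
    exact h.r2B hD hDne hx hy ho hoD hox hoy hoq (by grind)
  by_cases hqy : q = y
  · subst hqy
    exact h.r2B hD hDne hx hy ho hoD hox hoy hop hbd
  have P1 := h.sub3 hD hDne hx hy ho hoD hox hoy (a := x) (b := q) (c := p) (w := p) hxW hq hx hqD
    hqx.symm (by grind) hp hpD hpx hpq
  have P2 := h.sub3 hD hDne hx hy ho hoD hox hoy (a := x) (b := p) (c := q) (w := q) hxW hp hx hpD
    hpx.symm (by grind) hq hqD hqx hqp
  -- vertices outside `D` other than x, p, q have no neighbours in `D`
  have hnD : ∀ u ∈ W, u ∉ D → u ≠ x → u ≠ p → u ≠ q → ∀ v ∈ D, ¬ G.Adj u v := by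
    intro u hu huD h1 h2 h3 v hv huv
    have := hbd u hu huD ⟨v, hv, huv.symm⟩
    grind
  obtain ⟨Z, hZ⟩ : ∃ Z, Z = (W.erase x) \ D := ⟨_, rfl⟩
  have mZ : ∀ u, u ∈ Z ↔ u ∈ W ∧ u ≠ x ∧ u ∉ D := by intro u; rw [hZ]; grind
  have hdegZ : ∀ v ∈ W, v ∉ D → v ≠ x → v ≠ y → v ≠ p → v ≠ q → 3 ≤ #(nb G Z v) := by
    intro v hv hvD h1 h2 h3 h4
    have h5 := h.deg v hv h1 h2
    have h6 : #(nb G W v) ≤ #(nb G Z v) + 1 := by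
      apply card_nb_drop (c := x)
      intro u hu hvu
      have := hnD v hv hvD h1 h3 h4 u
      have := mZ u
      grind
    omega
  have hcomp : ¬ LAP (Pth G Z q y) 2 := by
    intro hl
    apply h.ng
    refine P1.add hl (by omega) (by omega) (by omega) (fun m n hm hn => hm.append hn ?_ ?_ ?_)
    · intro u; have := mZ u; grind
    · grind
    · grind
  have hntc : ¬ TC G Z q y := by
    intro htc
    apply hcomp
    refine lemma2 _ Z rfl G q y p htc ⟨o, by grind⟩ ?_
    intro v hv h1 h2 h3
    have := (mZ v).1 hv
    exact hdegZ v this.1 this.2.2 this.2.1 h2 h3 h1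
  obtain ⟨E, hE, hEne, hqE, hyE, e, hEe⟩ : ∃ E ⊆ Z, E.Nonempty ∧ q ∉ E ∧ y ∉ E ∧ ∃ e,
      ∀ u ∈ Z, u ∉ E → u ≠ e → ∀ v ∈ E, ¬ G.Adj v u := by
    by_contra hcon
    push Not at hcon
    refine hntc ⟨by grind, by grind, hqy, ⟨o, by grind⟩, ?_⟩
    intro E hE hEne hqE hyE e
    obtain ⟨u, h1, h2, h3, v, h4, h5⟩ := hcon E hE hEne hqE hyE e
    exact ⟨u, h1, h2, h3, v, h4, h5⟩
  have hEm : ∀ u ∈ E, u ∈ W ∧ u ≠ x ∧ u ∉ D := fun u hu => (mZ u).1 (hE hu)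
  have hpE : p ∈ E := by
    by_contra hpE
    obtain ⟨u, hu, huE, hux, hue, v, hv, hvu⟩ := c3 E (fun u hu => (hEm u hu).1) hEne
      (by grind) hyE p hp hpE hpx hpy x e
    have h1 := hEm v hv
    have h2 := hnD v h1.1 h1.2.2 h1.2.1 (by grind) (by grind) u
    have h3 := hEe u ((mZ u).2 ⟨hu, hux, fun h => h2 h hvu⟩) huE hue v hv
    exact h3 hvu
  have he : e ∈ Z ∧ e ∉ E ∧ e ≠ q := by
    obtain ⟨u, hu, huE, hux, huq, v, hv, hvu⟩ := c3 (D ∪ E) (by grind) ⟨p, by grind⟩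
      (by grind) (by grind) q hq (by grind) hqx hqy x q
    have huZ : u ∈ Z := (mZ u).2 ⟨hu, hux, by grind⟩
    by_cases hvD : v ∈ D
    · have := hbd u hu (by grind) ⟨v, hvD, hvu⟩
      grind
    · have hvE : v ∈ E := by grind
      have hue : u = e := by
        by_contra hue
        exact hEe u huZ (by grind) hue v hvE hvu
      subst hue
      exact ⟨huZ, by grind, huq⟩
  obtain ⟨heZ, heE, heq⟩ := he
  have heW := (mZ e).1 heZ
  by_cases hEp : ∃ v ∈ E, v ≠ p
  · obtain ⟨v0, hv0, hv0p⟩ := hEp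
    have htc : TC G (insert e E) p e := by
      refine ⟨by grind, by simp, by grind, ⟨v0, by grind⟩, ?_⟩
      intro D' hD' hne' hpD' heD' p0
      have hD'E : D' ⊆ E := by grind
      obtain ⟨u, hu, huE, hux, hue, v, hv, hvu⟩ := c3 D' (fun u hu => (hEm u (hD'E hu)).1) hne'
        (by grind) (by grind) p hp hpD' hpx hpy x p0
      have hvE := hD'E hv
      have h1 := hEm v hvE
      have h2 := hnD v h1.1 h1.2.2 h1.2.1 (by grind) (by grind) u
      have huZ : u ∈ Z := (mZ u).2 ⟨hu, hux, fun h => h2 h hvu⟩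
      refine ⟨u, ?_, huE, hue, v, hv, hvu⟩
      by_contra hcon
      exact hEe u huZ (by grind) (by grind) v hvE hvu
    have hl : LAP (Pth G (insert e E) p e) 2 := by
      refine lemma2 _ _ rfl G p e p htc ⟨v0, by grind⟩ ?_
      intro v hv hvp hve _
      have hvE : v ∈ E := by grind
      have h1 := hEm v hvE
      refine le_trans (hdegZ v h1.1 h1.2.2 h1.2.1 (by grind) hvp (by grind)) (card_le_card ?_)
      intro u
      simp only [mem_nb, mem_insert]
      rintro ⟨huZ, hvu⟩
      refine ⟨?_, hvu⟩
      by_contra hcon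
      exact hEe u huZ (by grind) (by grind) v hvE hvu
    obtain ⟨C, hC, heC, hcl, hcC⟩ := exists_comp G (W := Z \ E) (a := e) (by grind)
    have hCm : ∀ u ∈ C, u ∈ W ∧ u ≠ x ∧ u ∉ D ∧ u ∉ E := by
      intro u hu; have := hC hu; have := mZ u; grind
    have hyC : y ∈ C := by
      by_contra hyC
      have key : ∀ u ∈ W, u ∉ D ∪ E ∪ C → (∃ v ∈ D ∪ E ∪ C, G.Adj v u) → u = x ∨ u = q := by
        rintro u hu huQ ⟨v, hv, hvu⟩
        by_contra hcon
        have huZ : u ∈ Z := (mZ u).2 ⟨hu, by grind, by grind⟩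
        simp only [mem_union] at hv
        rcases hv with (hv | hv) | hv
        · have := hbd u hu (by grind) ⟨v, hv, hvu⟩
          grind
        · exact hEe u huZ (by grind) (by grind) v hv hvu
        · have := hcl v hv u (by grind) hvu
          grind
      by_cases hqC : q ∈ C
      · obtain ⟨u, hu, huE, hux, v, hv, hvu⟩ := h.tc.h (D ∪ E ∪ C) (by grind) ⟨p, by grind⟩
          (by grind) (by grind) x
        have := key u hu huE ⟨v, hv, hvu⟩
        grind
      · obtain ⟨u, hu, huE, hux, huq, v, hv, hvu⟩ := c3 (D ∪ E ∪ C) (by grind) ⟨p, by grind⟩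
          (by grind) (by grind) q hq (by grind) hqx hqy x q
        have := key u hu huE ⟨v, hv, hvu⟩
        grind
    obtain ⟨n, hn⟩ := hcC.path heC hyC
    apply h.ng
    have h1 : LAP (Pth G (insert x D ∪ E ∪ {e}) x e) k := by
      refine P2.add hl (by omega) (by omega) (by omega) (fun m n hm hn => hm.append hn ?_ ?_ ?_)
      · intro u; have := hEm u; grind
      · grind
      · grind
    refine h1.mono le_rfl n (fun m hm => hm.append hn ?_ ?_ ?_)
    · intro u; have := hCm u; grind
    · intro u; have := hEm u; grind
    · intro u; have := hCm u; grind
  · have hpZ : ∀ u ∈ Z, u ≠ p → u ≠ e → ¬ G.Adj p u := by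
      intro u hu hup hue
      exact hEe u hu (by grind) hue p hpE
    have hbd' : ∀ u ∈ W, u ∉ insert p D → (∃ v ∈ insert p D, G.Adj v u) → u = x ∨ u = e ∨ u = q := by
      rintro u hu huD ⟨v, hv, hvu⟩
      rw [mem_insert] at hv
      rcases hv with rfl | hv
      · have := hpZ u
        have := mZ u
        grind
      · have := hbd u hu (by grind) ⟨v, hv, hvu⟩
        grind
    by_cases hey : e = y
    · subst hey
      exact h.r2B (D := insert p D) (by grind) (by simp) (by grind) (by grind) ho (by grind) hox hoy hoq
        (by grind)
    by_cases hw : ∃ o' ∈ W, o' ∉ insert p D ∧ o' ≠ x ∧ o' ≠ y ∧ o' ≠ e ∧ o' ≠ q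
    · obtain ⟨o', g1, g2, g3, g4, g5, g6⟩ := hw
      refine ih _ ?_ (insert p D) e q o' rfl (by grind) (by simp) (by grind) (by grind) g1 g2 g3 g4 g5 g6
        hbd'
      have hs : insert p D ⊆ W := by grind
      have := card_le_card hs
      rw [card_insert_of_notMem hpD] at this ⊢
      omega
    · clear ih
      push Not at hw
      have hsub : nb G W e ⊆ {x, y, p, q} := by
        intro u
        rw [mem_nb]
        rintro ⟨hu, heu⟩
        have h1 := hnD e heW.1 heW.2.2 heW.2.1 (by grind) heq u
        have h2 := hw u hu
        have := heu.ne
        grind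
      have hdege := h.deg e heW.1 heW.2.1 hey
      have h4 : #({x, y, p, q} : Finset V) ≤ #(nb G W e) := le_trans card_le_four (by omega)
      have heqs := eq_of_subset_of_card_le hsub h4
      have hey' : G.Adj e y := by
        have : y ∈ nb G W e := by rw [heqs]; simp
        exact (mem_nb.1 this).2
      have heq' : G.Adj e q := by
        have : q ∈ nb G W e := by rw [heqs]; simp
        exact (mem_nb.1 this).2
      have hqy' : G.Adj q y := by
        obtain ⟨u, hu, huE, hux, hue, v, hv, hvu⟩ := c3 (((W.erase x).erase y).erase e) (by grind)
          ⟨p, by grind⟩ (by grind) (by grind) e heW.1 (by grind) heW.2.1 hey x e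
        have huy : u = y := by grind
        subst huy
        have h1 : v ∉ D := by
          intro hvD
          have := hbd u hu hy ⟨v, hvD, hvu⟩
          grind
        have h2 : v ≠ p := by
          rintro rfl
          exact hpZ u (by grind) (by grind) (by grind) hvu
        have h3 := hw v
        have : v = q := by grind
        exact this ▸ hvu
      apply hcomp
      refine lap2 (l := 1) (d := 1) (.inl rfl) ?_ ?_
      · exact Pth.edge hqy' (by grind) (by grind)
      · exact .cons (by grind) heq'.symm (Pth.edge hey' (by grind) (by grind))

theorem Ctx.r2' {G : SimpleGraph V} {W : Finset V} {x y k} (h : Ctx G W x y k)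
    {D : Finset V} {p q o : V} (h1 : D ⊆ W) (h2 : D.Nonempty) (h3 : x ∉ D) (h4 : y ∉ D)
    (h5 : o ∈ W) (h6 : o ∉ D) (h7 : o ≠ x) (h8 : o ≠ y) (h9 : o ≠ p) (h10 : o ≠ q)
    (h11 : ∀ u ∈ W, u ∉ D → (∃ v ∈ D, G.Adj v u) → u = x ∨ u = p ∨ u = q) : False :=
  h.r2 _ D p q o rfl h1 h2 h3 h4 h5 h6 h7 h8 h9 h10 h11

end
end Adm

namespace Adm
noncomputable section
open Classical Finset
variable {V : Type*}

theorem Ctx.two {G : SimpleGraph V} {W : Finset V} {x y k} (h : Ctx G W x y k) (p : V) :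
    ∃ v ∈ W, v ≠ p ∧ v ≠ x ∧ v ≠ y ∧ G.Adj y v := by
  have key : ∀ p ∈ W, p ≠ x → p ≠ y → ∃ v ∈ W, v ≠ p ∧ v ≠ x ∧ v ≠ y ∧ G.Adj y v := by
    intro p hp hpx hpy
    have h1 := h.deg p hp hpx hpy
    have hne : (((W.erase x).erase y).erase p).Nonempty := by
      by_contra hcon
      rw [not_nonempty_iff_eq_empty] at hcon
      have h2 : nb G W p ⊆ {x, y} := by
        intro u; rw [mem_nb]; rintro ⟨h1, h2⟩
        have := h2.ne
        by_contra h3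
        have : u ∈ ((W.erase x).erase y).erase p := by grind
        simp [hcon] at this
      have h3 := card_le_card h2
      have h4 := card_le_two (a := x) (b := y)
      have := h.hk
      omega
    obtain ⟨u, hu, huQ, hux, hup, v, hv, hvu⟩ := h.c3 (((W.erase x).erase y).erase p) (by grind) hne
      (by grind) (by grind) p hp (by grind) hpx hpy x p
    have : u = y := by grind
    subst this
    exact ⟨v, by grind, by grind, by grind, by grind, hvu.symm⟩
  obtain ⟨q, hq, hqx, hqy⟩ := h.tc.hex
  by_cases hp : p ∈ W ∧ p ≠ x ∧ p ≠ y
  · exact key p hp.1 hp.2.1 hp.2.2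
  · obtain ⟨v, h1, h2, h3, h4, h5⟩ := key q hq hqx hqy
    exact ⟨v, h1, by grind, h3, h4, h5⟩

theorem Ctx.core {G : SimpleGraph V} {W U M M2 : Finset V} {x y k L L2} (h : Ctx G W x y k)
    (hU : U ⊆ W) (hx : x ∈ U) (hyU : y ∉ U) (hMU : M ⊆ U) (hxM : x ∉ M) (hMne : M.Nonempty)
    (hL : 1 ≤ L) (hlap : LAP (fun n => ∀ m ∈ M, Pth G U x m n) L)
    (hlap2 : LAP (fun n => ∀ m ∈ M2, Pth G U x m n) L2)
    (hloss : ∀ v ∈ W, v ∉ U → v ≠ y → #(nb G U v)+1 ≤ ind G M v + L)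
    (hp : ∀ F f, F ⊆ W → F.Nonempty → (∀ v ∈ F, v ∉ U) → y ∉ F → (∀ v ∈ F, ∀ m ∈ M, ¬ G.Adj m v) →
      f ∈ W → f ∉ U → f ∉ F →
      (∀ u ∈ W, u ∉ F → (∃ v ∈ F, G.Adj v u) → u = f ∨ (u ∈ U ∧ u ∉ M)) →
      1 ≤ L2 ∧ (∃ v ∈ F, ∃ m ∈ M2, G.Adj m v) ∧ ∀ v ∈ F, #(nb G U v)+1 ≤ ind G M2 v + L2) :
    ∀ u ∈ W, G.Adj y u → u ∈ U := by
  intro u hu hyu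
  by_contra huU
  exact h.ng (core3 hU hx h.tc.hy hyU hMU hxM hMne hL hlap hlap2 h.main le_rfl
    (fun v hv hvU hvy => h.deg v hv (by grind) hvy) hloss ⟨u, hu, huU, hyu⟩ hp)

theorem Ctx.t1a {G : SimpleGraph V} {W K : Finset V} {x y k} (h : Ctx G W x y k) (hK : K ⊆ W)
    (hx : x ∈ K) (hc : ∀ u ∈ K, ∀ v ∈ K, u ≠ v → G.Adj u v) (h3 : 3 ≤ #K)
    (hmax : ∀ v ∈ W, v ∉ K → ∃ u ∈ K, ¬ G.Adj v u) : ∀ u ∈ W, G.Adj y u → u ∈ K := by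
  have hxy := h.tc.hne
  have hyK : y ∉ K := fun hy => h.nadj (hc x hx y hy hxy)
  have hcard := card_erase_of_mem hx
  refine h.core (M := K.erase x) (M2 := ∅) (L := #K - 1) (L2 := 0) hK hx hyK (erase_subset _ _) (by simp)
    (card_pos.1 (by omega)) (by omega) ?_ ⟨0, 1, .inl rfl, by simp⟩ ?_ ?_
  · refine ⟨1, 1, .inl rfl, ?_⟩
    intro i hi m hm
    have := clique_path (G := G) i hc hx (mem_erase.1 hm).2 (mem_erase.1 hm).1.symm (by omega)
    convert this using 1; omega
  · intro v hv hvK hvy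
    obtain ⟨u, hu, hvu⟩ := hmax v hv hvK
    have h1 : #(nb G K v) ≤ #(K.erase u) := card_le_card (by intro a; rw [mem_nb]; grind)
    rw [card_erase_of_mem hu] at h1
    by_cases hm : ∃ m ∈ K.erase x, G.Adj m v
    · obtain ⟨m, hm, hmv⟩ := hm
      rw [ind_of hm hmv]; omega
    · have : nb G K v ⊆ {x} := by
        intro a; rw [mem_nb]; rintro ⟨h4, h5⟩
        by_contra h6
        exact hm ⟨a, by grind, h5.symm⟩
      have := card_le_card this
      simp at this
      omega
  · intro F f hF hFne hFU hyF hFM hf hfU hfF hbd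
    exfalso
    obtain ⟨o, ho⟩ : (K.erase x).Nonempty := card_pos.1 (by omega)
    obtain ⟨u, hu, huQ, hux, huf, v, hv, hvu⟩ := h.c3 F hF hFne (by grind) hyF o (by grind) (by grind)
      (by grind) (by grind) x f
    have := hbd u hu huQ ⟨v, hv, hvu⟩
    grind

theorem ext_clique {G : SimpleGraph V} {W K0 : Finset V} (hK : K0 ⊆ W)
    (hc : ∀ u ∈ K0, ∀ v ∈ K0, u ≠ v → G.Adj u v) : ∃ K ⊆ W, K0 ⊆ K ∧
    (∀ u ∈ K, ∀ v ∈ K, u ≠ v → G.Adj u v) ∧ ∀ v ∈ W, v ∉ K → ∃ u ∈ K, ¬ G.Adj v u := by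
  obtain ⟨K, hK1, hK2⟩ := exists_max_image
    (W.powerset.filter (fun K => K0 ⊆ K ∧ ∀ u ∈ K, ∀ v ∈ K, u ≠ v → G.Adj u v)) card
    ⟨K0, by simp [hK]; exact hc⟩
  simp only [mem_filter, mem_powerset] at hK1 hK2
  refine ⟨K, hK1.1, hK1.2.1, hK1.2.2, ?_⟩
  intro v hv hvK
  by_contra hcon
  push Not at hcon
  have := hK2 (insert v K) ⟨by grind, by grind, ?_⟩
  · rw [card_insert_of_notMem hvK] at this; omega
  · intro a ha b hb hab
    rw [mem_insert] at ha hb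
    rcases ha with rfl | ha <;> rcases hb with rfl | hb
    · exact absurd rfl hab
    · exact hcon b hb
    · exact (hcon a ha).symm
    · exact hK1.2.2 a ha b hb hab

theorem Ctx.t1b {G : SimpleGraph V} {W K : Finset V} {x y k} (h : Ctx G W x y k) (hK : K ⊆ W)
    (hx : x ∈ K) (hc : ∀ u ∈ K, ∀ v ∈ K, u ≠ v → G.Adj u v) (h3 : 3 ≤ #K)
    (hNx : ∀ u ∈ W, G.Adj x u → u ∈ K) (hNy : ∀ u ∈ W, G.Adj y u → u ∈ K)
    (hy : ∀ u ∈ K, u ≠ x → G.Adj u y) : False := by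
  have hxy := h.tc.hne
  have hxW := h.tc.hx
  have hyW := h.tc.hy
  have hyK : y ∉ K := fun hy => h.nadj (hc x hx y hy hxy)
  have hcard := card_erase_of_mem hx
  obtain ⟨u1, hu1⟩ : (K.erase x).Nonempty := card_pos.1 (by omega)
  have hu1x := (mem_erase.1 hu1).1
  have hu1K := (mem_erase.1 hu1).2
  by_cases hk : k ≤ #K - 1
  · apply h.ng
    refine ⟨2, 1, .inl rfl, ?_⟩
    intro i hi
    have := clique_path (G := G) i hc hx hu1K hu1x.symm (by omega)
    convert this.snoc (hy u1 hu1K hu1x) hyK hK hyW using 1; omega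
  have hcard2 := card_erase_of_mem hu1
  have hcard3 := card_erase_of_mem hu1K
  have hny : ∀ v ∈ W, v ∉ K → ¬ G.Adj v y := fun v hv hvK hvy => hvK (hNy v hv hvy.symm)
  have hnx : ∀ v ∈ W, v ∉ K → ¬ G.Adj v x := fun v hv hvK hvy => hvK (hNx v hv hvy.symm)
  have key : LAP (Pth G (W.erase y) x u1) k := by
    refine core3 (W := W.erase y) (U := K.erase u1) (M := (K.erase x).erase u1) (M2 := ∅) (L := #K - 2)
      (L2 := 0) (N := #W) (by grind) (by grind) (by grind) (by simp) (by grind) (by simp)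
      (card_pos.1 (by omega)) (by omega) ?_ ⟨0, 1, .inl rfl, by simp⟩ h.main (card_le_card (erase_subset _ _))
      ?_ ?_ ?_ ?_
    · refine ⟨1, 1, .inl rfl, ?_⟩
      intro i hi m hm
      have := clique_path (G := G) (K := K.erase u1) (x := x) (m := m) i (by grind) (by grind) (by grind)
        (by grind) (by omega)
      convert this using 1; omega
    · intro v hv hvU hvu
      refine (h.deg v (by grind) (by grind) (by grind)).trans (card_le_card ?_)
      intro a; simp only [mem_nb, mem_erase]
      rintro ⟨h1, h2⟩
      refine ⟨⟨?_, h1⟩, h2⟩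
      rintro rfl
      exact hny v (by grind) (by grind) h2
    · intro v hv hvU hvu
      have h1 : nb G (K.erase u1) v ⊆ (K.erase x).erase u1 := by
        intro a; simp only [mem_nb, mem_erase]
        rintro ⟨h1, h2⟩
        refine ⟨h1.1, ?_, h1.2⟩
        rintro rfl
        exact hnx v (by grind) (by grind) h2
      by_cases hm : ∃ m ∈ (K.erase x).erase u1, G.Adj m v
      · have := card_le_card h1
        obtain ⟨m, hm, hmv⟩ := hm
        rw [ind_of hm hmv]; omega
      · have : nb G (K.erase u1) v = ∅ := by
          rw [eq_empty_iff_forall_notMem]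
          intro a ha
          exact hm ⟨a, h1 ha, (mem_nb.1 ha).2.symm⟩
        rw [this, card_empty]; omega
    · by_contra hcon
      push Not at hcon
      have h1 : nb G W u1 ⊆ insert y (K.erase u1) := by
        intro a; rw [mem_nb]
        rintro ⟨h1, h2⟩
        have := hcon a
        grind
      have h2 := card_le_card h1
      have h4 := card_insert_le y (K.erase u1)
      have := h.deg u1 (by grind) hu1x (by grind)
      omega
    · intro F f hF hFne hFU hu1F hFM hf hfU hfF hbd
      exfalso
      have hFK : ∀ v ∈ F, v ∈ W ∧ v ∉ K ∧ v ≠ y := by grind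
      obtain ⟨u, hu, huQ, huf, v, hv, hvu⟩ := h.tc.h F (by grind) hFne (by grind) (by grind) f
      have h1 := hFK v hv
      have h2 := hbd u
      have h4 := hny v h1.1 h1.2.1
      have h5 := hnx v h1.1 h1.2.1
      have : u ≠ y := by grind
      grind
  apply h.ng
  refine key.mono le_rfl 1 (fun n hn => hn.snoc (hy u1 hu1K hu1x) (by simp) (erase_subset _ _) hyW)

theorem Ctx.t1 {G : SimpleGraph V} {W : Finset V} {x y k} (h : Ctx G W x y k) {a b : V} (ha : a ∈ W)
    (hb : b ∈ W) (hxa : G.Adj x a) (hxb : G.Adj x b) (hab : G.Adj a b) : False := by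
  have hxy := h.tc.hne
  have hxW := h.tc.hx
  have hyW := h.tc.hy
  have tri : ∀ {x a b : V}, G.Adj x a → G.Adj x b → G.Adj a b → 
      (∀ u ∈ ({x, a, b} : Finset V), ∀ v ∈ ({x, a, b} : Finset V), u ≠ v → G.Adj u v) ∧
      #({x, a, b} : Finset V) = 3 := by
    intro x a b h1 h2 h3
    refine ⟨?_, ?_⟩
    · have := h1.symm
      have := h2.symm
      have := h3.symm
      intro u hu v hv huv
      simp only [mem_insert, mem_singleton] at hu hv
      rcases hu with rfl | rfl | rfl <;> rcases hv with rfl | rfl | rfl <;> first | assumption | exact absurd rfl huv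
    · rw [card_eq_three]; exact ⟨x, a, b, h1.ne, h2.ne, h3.ne, rfl⟩
  obtain ⟨t1, t2⟩ := tri hxa hxb hab
  obtain ⟨K, hK, hK0, hc, hmax⟩ := ext_clique (W := W) (K0 := {x, a, b}) (by simp only [insert_subset_iff, singleton_subset_iff]; exact ⟨hxW, ha, hb⟩) t1
  have hK3 := card_le_card hK0
  have hNy := h.t1a hK (by grind) hc (by omega) hmax
  obtain ⟨u, hu, -, -, -, hyu⟩ := h.two x
  obtain ⟨v, hv, hvu, -, -, hyv⟩ := h.two u
  have huv : G.Adj u v := hc u (hNy u hu hyu) v (hNy v hv hyv) hvu.symm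
  obtain ⟨t3, t4⟩ := tri hyu hyv huv
  obtain ⟨K', hK', hK0', hc', hmax'⟩ := ext_clique (W := W) (K0 := {y, u, v}) (by simp only [insert_subset_iff, singleton_subset_iff]; exact ⟨hyW, hu, hv⟩) t3
  have hK3' := card_le_card hK0'
  have hNx := h.symm.t1a hK' (by grind) hc' (by omega) hmax'
  have hxK : x ∈ K := by grind
  have hyK' : y ∈ K' := by grind
  have hyK : y ∉ K := fun hy => h.nadj (hc x hxK y hy hxy)
  have e1 : ∀ u ∈ K, u ≠ x → G.Adj u y := by
    intro u hu hux
    have := hNx u (hK hu) (hc x hxK u hu hux.symm)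
    exact hc' u this y hyK' (by grind)
  refine h.t1b hK hxK hc (by omega) ?_ hNy e1
  intro u hu hxu
  have h1 := hNx u hu hxu
  refine hNy u hu (hc' y hyK' u h1 ?_)
  rintro rfl
  exact h.nadj hxu

end
end Adm

namespace Adm
noncomputable section
open Classical Finset
variable {V : Type*}

set_option maxHeartbeats 4000000 in
theorem Ctx.t3twin {G : SimpleGraph V} {W A : Finset V} {x y s t k} (h : Ctx G W x y k)
    (hA : A ⊆ W) (hs : s ∈ W) (ht : t ∈ W) (hst : s ≠ t) (hyA : y ∉ A)
    (h2 : 2 ≤ #A) (hc : ∀ u ∈ A, ∀ v ∈ A, u ≠ v → G.Adj u v) (hxs : G.Adj x s) (hxt : G.Adj x t)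
    (hsA : ∀ u ∈ A, G.Adj s u) (htA : ∀ u ∈ A, G.Adj t u)
    (hmax : ∀ v ∈ W, v ≠ x → v ≠ y → v ∉ A → v ≠ s → ¬ G.Adj v s ∨ ∃ u ∈ A, ¬ G.Adj v u) :
    ∀ u ∈ W, G.Adj y u → u = s ∨ u = t := by
  have hxy := h.tc.hne
  have hxW := h.tc.hx
  have hyW := h.tc.hy
  have t1 : ∀ a ∈ W, ∀ b ∈ W, G.Adj x a → G.Adj a b → ¬ G.Adj x b :=
    fun a ha b hb h1 h2 h3 => h.t1 ha hb h1 h3 h2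
  have t1' : ∀ a ∈ W, ∀ b ∈ W, G.Adj y a → G.Adj a b → ¬ G.Adj y b :=
    fun a ha b hb h1 h2 h3 => h.symm.t1 ha hb h1 h3 h2
  have hys : y ≠ s := fun e => h.nadj (e ▸ hxs)
  have hyt : y ≠ t := fun e => h.nadj (e ▸ hxt)
  have hxA : ∀ u ∈ A, ¬ G.Adj x u := fun u hu => t1 s hs u (hA hu) hxs (hsA u hu)
  have hsA' : s ∉ A := fun e => hxA s e hxs
  have htA' : t ∉ A := fun e => hxA t e hxt
  have hxA' : x ∉ A := by
    intro e
    obtain ⟨u, hu, hux⟩ := exists_mem_ne (s := A) (by omega) x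
    exact hxA u hu (hc x e u hu hux.symm)
  obtain ⟨U, hU⟩ : ∃ U, U = insert x (insert s (insert t A)) := ⟨_, rfl⟩
  have mU : ∀ u, u ∈ U ↔ u = x ∨ u = s ∨ u = t ∨ u ∈ A := by intro u; rw [hU]; simp
  have hAne : A.Nonempty := card_pos.1 (by omega)
  have cl : ∀ p, p ∉ A → (∀ u ∈ A, G.Adj p u) → ∀ u ∈ insert p A, ∀ v ∈ insert p A, u ≠ v → G.Adj u v := by
    intro p hp hpA u hu v hv huv
    rw [mem_insert] at hu hv
    rcases hu with rfl | hu <;> rcases hv with rfl | hv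
    · exact absurd rfl huv
    · exact hpA v hv
    · exact (hpA u hu).symm
    · exact hc u hu v hv huv
  have pp : ∀ s t, s ∉ A → t ∉ A → s ≠ t → x ≠ s → x ≠ t → s ∈ U → t ∈ U → (∀ u ∈ A, G.Adj s u) → (∀ u ∈ A, G.Adj t u) →
      G.Adj x t → ∀ i < #A, Pth G U x s (3 + 1 * i) := by
    intro s t hs ht hst hxs hxt hsU htU hsA htA hx i hi
    obtain ⟨c, hcA⟩ := hAne
    have h1 := clique_path (G := G) (K := insert s A) (x := c) (m := s) i (cl s hs hsA) (by grind)
      (by grind) (by grind) (by rw [card_insert_of_notMem hs]; omega)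
    have h3 : Pth G U x s (((i + 1) + 1) + 1) := by
      refine .cons (by grind) hx (.cons (by grind) (htA c hcA) (h1.mono ?_))
      intro u; have := mU u; grind
    convert h3 using 1; omega
  have key : ∀ u ∈ W, G.Adj y u → u ∈ U := by
    refine h.core (M := A) (M2 := {s, t}) (L := #A + 1) (L2 := #A) (by intro u; have := mU u; grind)
      (by grind) (by grind) (by grind) hxA' hAne (by omega) ?_ ?_ ?_ ?_
    · refine ⟨2, 1, .inl rfl, ?_⟩
      intro i hi m hm
      by_cases hi' : i < #A
      · have h1 := clique_path (G := G) (K := insert s A) (x := s) (m := m) i (cl s hsA' hsA) (by grind)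
          (by grind) (by grind) (by rw [card_insert_of_notMem hsA']; omega)
        have h3 : Pth G U x m ((i + 1) + 1) := by
          refine .cons (by grind) hxs (h1.mono ?_)
          intro u; have := mU u; grind
        convert h3 using 1; omega
      · obtain ⟨c, hcA, hcm⟩ := exists_mem_ne (s := A) (by omega) m
        have h1 := clique_path (G := G) (K := insert t (A.erase c)) (x := t) (m := m) (#A - 2)
          (fun u hu v hv => cl t htA' htA u (by grind) v (by grind)) (by grind)
          (by grind) (by grind) (by rw [card_insert_of_notMem (by grind), card_erase_of_mem hcA]; omega)
        have h3 : Pth G U x m ((((#A - 2 + 1) + 1) + 1) + 1) := by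
          refine .cons (by grind) hxs (.cons (by grind) (hsA c hcA) (.cons (by grind) (htA c hcA).symm (h1.mono ?_)))
          intro u; have := mU u; grind
        convert h3 using 1; omega
    · refine ⟨3, 1, .inl rfl, ?_⟩
      intro i hi m hm
      rw [mem_insert, mem_singleton] at hm
      rcases hm with rfl | rfl
      · exact pp m t hsA' htA' hst hxs.ne hxt.ne (by grind) (by grind) hsA htA hxt i hi
      · exact pp m s htA' hsA' hst.symm hxt.ne hxs.ne (by grind) (by grind) htA hsA hxs i hi
    · intro v hv hvU hvy
      have hvU' := (mU v).not.1 hvU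
      push Not at hvU'
      obtain ⟨g1, g2, g3, g4⟩ := hvU'
      by_cases hvx : G.Adj x v
      · have h5 := t1 v hv s hs hvx
        have h6 := t1 v hv t ht hvx
        have h7 : nb G U v ⊆ insert x (nb G A v) := by
          intro u; simp only [mem_nb, mem_insert, mU]; grind
        have h8 := card_le_card h7
        have h9 := card_insert_le x (nb G A v)
        have h10 : #(nb G A v) ≤ #A := card_le_card (filter_subset _ _)
        by_cases hm : ∃ m ∈ A, G.Adj m v
        · obtain ⟨m, hm, hmv⟩ := hm
          rw [ind_of hm hmv]; omega
        · have : nb G A v = ∅ := by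
            rw [eq_empty_iff_forall_notMem]
            intro a ha
            exact hm ⟨a, (mem_nb.1 ha).1, (mem_nb.1 ha).2.symm⟩
          rw [this] at h8 h9; rw [card_empty] at h9; omega
      · have hvx' : ¬ G.Adj v x := fun e => hvx e.symm
        by_cases hm : ∃ m ∈ A, G.Adj m v
        · have : ∃ w, w ∈ insert s (insert t A) ∧ nb G U v ⊆ (insert s (insert t A)).erase w := by
            rcases hmax v hv g1 hvy g4 g2 with h5 | ⟨w, hw, h5⟩
            · refine ⟨s, by grind, ?_⟩
              intro u; simp only [mem_nb, mem_insert, mU, mem_erase]; grind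
            · refine ⟨w, by grind, ?_⟩
              intro u; simp only [mem_nb, mem_insert, mU, mem_erase]; grind
          obtain ⟨w, hw, hs⟩ := this
          have := card_le_card hs
          rw [card_erase_of_mem hw, card_insert_of_notMem (by grind), card_insert_of_notMem (by grind)] at this
          obtain ⟨m, hm, hmv⟩ := hm
          rw [ind_of hm hmv]; omega
        · have : nb G U v ⊆ {s, t} := by
            intro u; simp only [mem_nb, mem_insert, mU, mem_singleton]
            rintro ⟨h5, h6⟩
            have : u ∉ A := fun hu => hm ⟨u, hu, h6.symm⟩
            grind
          have := (card_le_card this).trans card_le_two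
          omega
    · intro F f hF hFne hFU hyF hFM hf hfU hfF hbd
      obtain ⟨o, ho⟩ := hAne
      have hFU' : ∀ v ∈ F, v ∈ W ∧ v ≠ x ∧ v ≠ s ∧ v ≠ t ∧ v ∉ A := by
        intro v hv; have := hFU v hv; have := (mU v).not.1 this; have := hF hv; grind
      have hfU' := (mU f).not.1 hfU
      refine ⟨by omega, ?_, ?_⟩
      · by_contra hcon
        push Not at hcon
        obtain ⟨u, hu, huF, hux, huf, v, hv, hvu⟩ := h.c3 F hF hFne (by grind) hyF o (hA ho) (by grind)
          (by grind) (by grind) x f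
        have h5 := hbd u hu huF ⟨v, hv, hvu⟩
        rw [mU] at h5
        have h6 := hcon v hv u
        have := hvu.symm
        grind
      · intro v hv
        have hvW := hFU' v hv
        by_cases hvx : G.Adj x v
        · have h5 := t1 v hvW.1 s hs hvx
          have h6 := t1 v hvW.1 t ht hvx
          have h7 : nb G U v ⊆ {x} := by
            intro u; simp only [mem_nb, mem_singleton, mU]
            rintro ⟨h8, h9⟩
            have := hFM v hv u
            have := h9.symm
            grind
          have := card_le_card h7
          rw [card_singleton] at this
          omega
        · have hvx' : ¬ G.Adj v x := fun e => hvx e.symm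
          have h7 : nb G U v ⊆ {s, t} := by
            intro u; simp only [mem_nb, mem_singleton, mU, mem_insert]
            rintro ⟨h8, h9⟩
            have := hFM v hv u
            have := h9.symm
            grind
          have h8 := (card_le_card h7).trans card_le_two
          by_cases hm : ∃ m ∈ ({s, t} : Finset V), G.Adj m v
          · obtain ⟨m, hm, hmv⟩ := hm
            rw [ind_of hm hmv]; omega
          · have : nb G U v = ∅ := by
              rw [eq_empty_iff_forall_notMem]
              intro a ha
              exact hm ⟨a, h7 ha, (mem_nb.1 ha).2.symm⟩
            rw [this, card_empty]; omega
  intro u hu hyu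
  have h5 := (mU u).1 (key u hu hyu)
  by_contra hcon
  have huA : u ∈ A := by
    have : u ≠ x := fun e => h.nadj (e ▸ hyu.symm)
    grind
  obtain ⟨v, hv, hvu, -, -, hyv⟩ := h.two u
  have h6 := (mU v).1 (key v hv hyv)
  have h7 := t1' u hu v hv hyu
  have hvx : v ≠ x := fun e => h.nadj (e ▸ hyv.symm)
  have : G.Adj u v := by
    rcases h6 with h6 | rfl | rfl | h6
    · exact absurd h6 hvx
    · exact (hsA u huA).symm
    · exact (htA u huA).symm
    · exact hc u huA v h6 hvu.symm
  exact h7 this hyv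

set_option maxHeartbeats 4000000 in
theorem Ctx.t3one {G : SimpleGraph V} {W A : Finset V} {x y s k} (h : Ctx G W x y k)
    (hA : A ⊆ W) (hs : s ∈ W) (hyA : y ∉ A) (hxA' : x ∉ A)
    (h2 : 2 ≤ #A) (hc : ∀ u ∈ A, ∀ v ∈ A, u ≠ v → G.Adj u v) (hxs : G.Adj x s)
    (hsA : ∀ u ∈ A, G.Adj s u)
    (htw : ∀ t ∈ W, t ≠ s → G.Adj x t → ∃ u ∈ A, ¬ G.Adj t u)
    (hmax : ∀ v ∈ W, v ≠ x → v ≠ y → v ∉ A → v ≠ s → ¬ G.Adj v s ∨ ∃ u ∈ A, ¬ G.Adj v u) :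
    False := by
  have hxy := h.tc.hne
  have hxW := h.tc.hx
  have hyW := h.tc.hy
  have t1 : ∀ a ∈ W, ∀ b ∈ W, G.Adj x a → G.Adj a b → ¬ G.Adj x b :=
    fun a ha b hb h1 h2 h3 => h.t1 ha hb h1 h3 h2
  have t1' : ∀ a ∈ W, ∀ b ∈ W, G.Adj y a → G.Adj a b → ¬ G.Adj y b :=
    fun a ha b hb h1 h2 h3 => h.symm.t1 ha hb h1 h3 h2
  have hys : y ≠ s := fun e => h.nadj (e ▸ hxs)
  have hxA : ∀ u ∈ A, ¬ G.Adj x u := fun u hu => t1 s hs u (hA hu) hxs (hsA u hu)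
  have hsA' : s ∉ A := fun e => hxA s e hxs
  obtain ⟨U, hU⟩ : ∃ U, U = insert x (insert s A) := ⟨_, rfl⟩
  have mU : ∀ u, u ∈ U ↔ u = x ∨ u = s ∨ u ∈ A := by intro u; rw [hU]; simp
  have hAne : A.Nonempty := card_pos.1 (by omega)
  have cl : ∀ u ∈ insert s A, ∀ v ∈ insert s A, u ≠ v → G.Adj u v := by
    intro u hu v hv huv
    rw [mem_insert] at hu hv
    rcases hu with rfl | hu <;> rcases hv with rfl | hv
    · exact absurd rfl huv
    · exact hsA v hv
    · exact (hsA u hu).symm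
    · exact hc u hu v hv huv
  have key : ∀ u ∈ W, G.Adj y u → u ∈ U := by
    refine h.core (M := A) (M2 := ∅) (L := #A) (L2 := 0) (by intro u; have := mU u; grind)
      (by grind) (by grind) (by grind) hxA' hAne (by omega) ?_ ⟨0, 1, .inl rfl, by simp⟩ ?_ ?_
    · refine ⟨2, 1, .inl rfl, ?_⟩
      intro i hi m hm
      have h1 := clique_path (G := G) (K := insert s A) (x := s) (m := m) i cl (by grind)
        (by grind) (by grind) (by rw [card_insert_of_notMem hsA']; omega)
      have h3 : Pth G U x m ((i + 1) + 1) := by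
        refine .cons (by grind) hxs (h1.mono ?_)
        intro u; have := mU u; grind
      convert h3 using 1; omega
    · intro v hv hvU hvy
      have hvU' := (mU v).not.1 hvU
      push Not at hvU'
      obtain ⟨g1, g2, g4⟩ := hvU'
      by_cases hvx : G.Adj x v
      · have h5 := t1 v hv s hs hvx
        have h7 : nb G U v ⊆ insert x (nb G A v) := by
          intro u; simp only [mem_nb, mem_insert, mU]; grind
        have h8 := card_le_card h7
        have h9 := card_insert_le x (nb G A v)
        obtain ⟨w, hw, hvw⟩ := htw v hv g2 hvx
        have h10 : #(nb G A v) ≤ #(A.erase w) := card_le_card (by intro u; simp only [mem_nb]; grind)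
        rw [card_erase_of_mem hw] at h10
        by_cases hm : ∃ m ∈ A, G.Adj m v
        · obtain ⟨m, hm, hmv⟩ := hm
          rw [ind_of hm hmv]; omega
        · have : nb G A v = ∅ := by
            rw [eq_empty_iff_forall_notMem]
            intro a ha
            exact hm ⟨a, (mem_nb.1 ha).1, (mem_nb.1 ha).2.symm⟩
          rw [this] at h8 h9; rw [card_empty] at h9; omega
      · have hvx' : ¬ G.Adj v x := fun e => hvx e.symm
        by_cases hm : ∃ m ∈ A, G.Adj m v
        · have : ∃ w, w ∈ insert s A ∧ nb G U v ⊆ (insert s A).erase w := by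
            rcases hmax v hv g1 hvy g4 g2 with h5 | ⟨w, hw, h5⟩
            · refine ⟨s, by grind, ?_⟩
              intro u; simp only [mem_nb, mem_insert, mU, mem_erase]; grind
            · refine ⟨w, by grind, ?_⟩
              intro u; simp only [mem_nb, mem_insert, mU, mem_erase]; grind
          obtain ⟨w, hw, hs⟩ := this
          have := card_le_card hs
          rw [card_erase_of_mem hw, card_insert_of_notMem (by grind)] at this
          obtain ⟨m, hm, hmv⟩ := hm
          rw [ind_of hm hmv]; omega
        · have : nb G U v ⊆ {s} := by
            intro u; simp only [mem_nb, mU, mem_singleton]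
            rintro ⟨h5, h6⟩
            have : u ∉ A := fun hu => hm ⟨u, hu, h6.symm⟩
            grind
          have := card_le_card this
          rw [card_singleton] at this
          omega
    · intro F f hF hFne hFU hyF hFM hf hfU hfF hbd
      exfalso
      obtain ⟨o, ho⟩ := hAne
      have hfU' := (mU f).not.1 hfU
      refine h.r2' (D := F) (p := s) (q := f) (o := o) hF hFne (by grind) hyF (hA ho) (by grind) (by grind)
        (by grind) (by grind) (by grind) ?_
      intro u hu huF hv
      have := hbd u hu huF hv
      rw [mU] at this
      grind
  obtain ⟨u, hu, -, hux, -, hyu⟩ := h.two x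
  obtain ⟨v, hv, hvu, hvx, -, hyv⟩ := h.two u
  have h5 := (mU u).1 (key u hu hyu)
  have h6 := (mU v).1 (key v hv hyv)
  exact t1' u hu v hv hyu (cl u (by grind) v (by grind) hvu.symm) hyv

set_option maxHeartbeats 4000000 in
theorem Ctx.t3 {G : SimpleGraph V} {W : Finset V} {x y k} (h : Ctx G W x y k) {a b c : V} (ha : a ∈ W)
    (hb : b ∈ W) (hc : c ∈ W) (hxa : G.Adj x a) (hab : G.Adj a b) (hac : G.Adj a c)
    (hbc : G.Adj b c) : False := by
  have hxy := h.tc.hne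
  have hxW := h.tc.hx
  have hyW := h.tc.hy
  have nx : ∀ d ∈ W, G.Adj a d → d ≠ x → ¬ G.Adj x d := fun d hd h1 _ h3 => h.t1 ha hd hxa h3 h1
  have hay : a ≠ y := fun e => h.nadj (e ▸ hxa)
  have hbx : b ≠ x := by rintro rfl; exact h.t1 ha hc hxa hbc hac
  have hcx : c ≠ x := by rintro rfl; exact h.t1 ha hb hxa hbc.symm hab
  have hby : b ≠ y := by rintro rfl; exact h.symm.t1 ha hc hab.symm hbc hac
  have hcy : c ≠ y := by rintro rfl; exact h.symm.t1 ha hb hac.symm hbc.symm hab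
  have hba := hab.symm
  have hca := hac.symm
  have hcb := hbc.symm
  obtain ⟨K, hK, hK0, hcl, hmax⟩ := ext_clique (G := G) (W := (W.erase x).erase y) (K0 := {a, b, c})
    (by
      simp only [insert_subset_iff, singleton_subset_iff, mem_erase]
      exact ⟨⟨hay, hxa.ne', ha⟩, ⟨hby, hbx, hb⟩, ⟨hcy, hcx, hc⟩⟩)
    (by
      intro u hu v hv huv
      simp only [mem_insert, mem_singleton] at hu hv
      rcases hu with rfl | rfl | rfl <;> rcases hv with rfl | rfl | rfl <;>
        first | assumption | exact absurd rfl huv)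
  have h3 : 3 ≤ #K := by
    have : #({a, b, c} : Finset V) = 3 := by
      rw [card_eq_three]; exact ⟨a, b, c, hab.ne, hac.ne, hbc.ne, rfl⟩
    have := card_le_card hK0
    omega
  have haK : a ∈ K := hK0 (by simp)
  have hKW : ∀ u ∈ K, u ∈ W ∧ u ≠ x ∧ u ≠ y := by
    intro u hu; have := hK hu; simp only [mem_erase] at this; tauto
  have hcard := card_erase_of_mem haK
  have hA : K.erase a ⊆ W := fun u hu => (hKW u (mem_erase.1 hu).2).1
  have hmax' : ∀ v ∈ W, v ≠ x → v ≠ y → v ∉ K.erase a → v ≠ a → ¬ G.Adj v a ∨ ∃ u ∈ K.erase a, ¬ G.Adj v u := by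
    intro v hv hvx hvy hvK hva
    obtain ⟨u, hu, hvu⟩ := hmax v (by grind) (by grind)
    by_cases hua : u = a
    · left; exact hua ▸ hvu
    · right; exact ⟨u, by grind, hvu⟩
  have hclA : ∀ u ∈ K.erase a, ∀ v ∈ K.erase a, u ≠ v → G.Adj u v := fun u hu v hv =>
    hcl u (mem_erase.1 hu).2 v (mem_erase.1 hv).2
  have haA : ∀ u ∈ K.erase a, G.Adj a u := fun u hu => hcl a haK u (mem_erase.1 hu).2 (mem_erase.1 hu).1.symm
  have hxA : x ∉ K.erase a := fun e => (hKW x (mem_erase.1 e).2).2.1 rfl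
  have hyA : y ∉ K.erase a := fun e => (hKW y (mem_erase.1 e).2).2.2 rfl
  by_cases htw : ∃ t ∈ W, t ≠ a ∧ G.Adj x t ∧ ∀ u ∈ K.erase a, G.Adj t u
  · obtain ⟨t, ht, hta, hxt, htA⟩ := htw
    have hy := h.t3twin hA ha ht hta.symm hyA (by omega) hclA hxa hxt haA htA hmax'
    have hya : G.Adj y a := by
      obtain ⟨u, hu, hut, -, -, hyu⟩ := h.two t
      rcases hy u hu hyu with rfl | rfl
      · exact hyu
      · exact absurd rfl hut
    have hyt : G.Adj y t := by
      obtain ⟨u, hu, hut, -, -, hyu⟩ := h.two a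
      rcases hy u hu hyu with rfl | rfl
      · exact absurd rfl hut
      · exact hyu
    have hx := h.symm.t3twin hA ha ht hta.symm hxA (by omega) hclA hya hyt haA htA
      (fun v hv h1 h2 => hmax' v hv h2 h1)
    obtain ⟨o, ho⟩ : (K.erase a).Nonempty := card_pos.1 (by omega)
    have hoW := hKW o (mem_erase.1 ho).2
    have hot : o ≠ t := by rintro rfl; exact (htA o ho).ne rfl
    obtain ⟨u, hu, huQ, hua, hut, v, hv, hvu⟩ := h.c3 ((((W.erase x).erase y).erase a).erase t)
      (fun u hu => by simp only [mem_erase] at hu; tauto) ⟨o, by simp only [mem_erase]; exact ⟨hot, (mem_erase.1 ho).1, hoW.2.2, hoW.2.1, hoW.1⟩⟩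
      (by simp) (by simp) a ha (by simp) hxa.ne' hay a t
    simp only [mem_erase] at hv huQ
    have h1 := hx v hv.2.2.2.2
    have h2 := hy v hv.2.2.2.2
    have h4 := hvu.symm
    by_cases hux : u = x
    · subst hux; tauto
    · by_cases huy : u = y
      · subst huy; tauto
      · tauto
  · push Not at htw
    exact h.t3one hA ha hyA hxA (by omega) hclA hxa haA htw hmax'

end
end Adm

namespace Adm
noncomputable section
open Classical Finset
variable {V : Type*}

structure Bip (G : SimpleGraph V) (W : Finset V) (x y : V) (S T : Finset V) : Prop where
  hS : S ⊆ W
  hx : x ∈ S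
  hy : y ∉ S
  mT : ∀ t, t ∈ T ↔ t ∈ W ∧ ∀ s ∈ S, G.Adj s t
  hle : #S ≤ #T
  hmax : ∀ v ∈ W, v ∉ S → v ≠ y → #(nb G T v) ≤ #S

theorem Ctx.exBip {G : SimpleGraph V} {W : Finset V} {x y k} (h : Ctx G W x y k) :
    ∃ S T, Bip G W x y S T := by
  have hxy := h.tc.hne
  have hxW := h.tc.hx
  obtain ⟨u, hu, -, -, -, hxu⟩ := h.symm.two x
  obtain ⟨S, hS1, hS2⟩ := exists_max_image
    (W.powerset.filter (fun S => x ∈ S ∧ y ∉ S ∧ #S ≤ #(W.filter (fun t => ∀ s ∈ S, G.Adj s t)))) card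
    ⟨{x}, by
      simp only [mem_filter, mem_powerset, singleton_subset_iff, mem_singleton, card_singleton]
      refine ⟨hxW, trivial, hxy.symm, card_pos.2 ⟨u, ?_⟩⟩
      simp [hu, hxu]⟩
  simp only [mem_filter, mem_powerset] at hS1 hS2
  refine ⟨S, _, hS1.1, hS1.2.1, hS1.2.2.1, fun t => mem_filter, hS1.2.2.2, ?_⟩
  intro v hv hvS hvy
  by_contra hcon
  have := hS2 (insert v S) ⟨by grind, by grind, by grind, ?_⟩
  · rw [card_insert_of_notMem hvS] at this; omega
  · rw [card_insert_of_notMem hvS]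
    refine (not_le.1 hcon).trans_le (card_le_card ?_)
    intro t; simp only [mem_nb, mem_filter, mem_insert]
    rintro ⟨⟨h1, h2⟩, h3⟩
    refine ⟨h1, ?_⟩
    rintro s (rfl | hs)
    · exact h3
    · exact h2 s hs

set_option maxHeartbeats 4000000 in
theorem Ctx.t2a {G : SimpleGraph V} {W S T : Finset V} {x y k} (h : Ctx G W x y k)
    (b : Bip G W x y S T) : ∀ u ∈ W, G.Adj y u → u ∈ S ∪ T := by
  obtain ⟨hS, hx, hy, mT, hle, hmax⟩ := b
  have hxy := h.tc.hne
  have hxW := h.tc.hx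
  have hyW := h.tc.hy
  have hST : ∀ s ∈ S, ∀ t ∈ T, G.Adj s t := fun s hs t ht => ((mT t).1 ht).2 s hs
  have hTW : ∀ t ∈ T, t ∈ W := fun t ht => ((mT t).1 ht).1
  have hd : ∀ s ∈ S, s ∉ T := fun s hs ht => (hST s hs s ht).ne rfl
  have hyT : y ∉ T := fun ht => h.nadj (hST x hx y ht)
  have hcard := card_erase_of_mem hx
  have hSpos : 0 < #S := card_pos.2 ⟨x, hx⟩
  obtain ⟨o, ho⟩ : T.Nonempty := card_pos.1 (by omega)
  have tri : ∀ v ∈ W, ∀ t ∈ T, G.Adj v t → ∀ s ∈ S, ¬ G.Adj v s := by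
    intro v hv t ht hvt s hs hvs
    exact h.t3 (hTW t ht) hv (hS hs) (hST x hx t ht) hvt.symm (hST s hs t ht).symm hvs
  have miss : ∀ v ∈ W, v ∉ T → ∃ s ∈ S, ¬ G.Adj v s := by
    intro v hv hvT
    have := (mT v).not.1 hvT
    push Not at this
    obtain ⟨s, hs, h1⟩ := this hv
    exact ⟨s, hs, fun h2 => h1 h2.symm⟩
  have nbS : ∀ v ∈ W, v ∉ T → (∀ t ∈ T, ¬ G.Adj t v) → #(nb G (S ∪ T) v) + 1 ≤ #S ∧ nb G (S ∪ T) v ⊆ S := by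
    intro v hv hvT hvT'
    obtain ⟨s, hs, hvs⟩ := miss v hv hvT
    have h1 : nb G (S ∪ T) v ⊆ S.erase s := by
      intro u; simp only [mem_nb, mem_union, mem_erase]
      rintro ⟨h1, h2⟩
      refine ⟨fun e => hvs (e ▸ h2), h1.resolve_right (fun h3 => hvT' u h3 h2.symm)⟩
    have h2 := card_le_card h1
    rw [card_erase_of_mem hs] at h2
    exact ⟨by omega, h1.trans (erase_subset _ _)⟩
  refine h.core (M := T) (M2 := S.erase x) (L := #S) (L2 := #S - 1) (union_subset hS hTW)
    (by grind) (by grind) (by grind) (hd x hx) ⟨o, ho⟩ (by omega) ?_ ?_ ?_ ?_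
  · exact ⟨1, 2, .inr rfl, fun i hi m hm => bip_path i hST hd hx hm hi (by omega)⟩
  · refine ⟨2, 2, .inr rfl, fun i hi m hm => ?_⟩
    exact bip_path' i hST hd hx (mem_erase.1 hm).2 (mem_erase.1 hm).1.symm (by omega) (by omega)
  · intro v hv hvU hvy
    rw [mem_union] at hvU
    push Not at hvU
    by_cases hm : ∃ m ∈ T, G.Adj m v
    · obtain ⟨m, hm, hmv⟩ := hm
      have h1 : nb G (S ∪ T) v ⊆ nb G T v := by
        intro u; simp only [mem_nb, mem_union]
        rintro ⟨h1, h2⟩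
        exact ⟨h1.resolve_left (fun h3 => tri v hv m hm hmv.symm u h3 h2), h2⟩
      have h2 := card_le_card h1
      have h3 := hmax v hv hvU.1 hvy
      rw [ind_of hm hmv]; omega
    · push Not at hm
      have := (nbS v hv hvU.2 hm).1
      omega
  · intro F f hF hFne hFU hyF hFM hf hfU hfF hbd
    have hFU' : ∀ v ∈ F, v ∈ W ∧ v ∉ S ∧ v ∉ T := by grind
    have adj : ∃ v ∈ F, ∃ m ∈ S.erase x, G.Adj m v := by
      by_contra hcon
      push Not at hcon
      obtain ⟨u, hu, huF, hux, huf, v, hv, hvu⟩ := h.c3 F hF hFne (by grind) hyF o (hTW o ho) (by grind)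
        (by grind) (by grind) x f
      have h5 := hbd u hu huF ⟨v, hv, hvu⟩
      have h6 := hcon v hv u
      have := hvu.symm
      grind
    have h2 : 2 ≤ #S := by
      obtain ⟨_, _, m, hm, _⟩ := adj
      have := card_pos.2 ⟨m, hm⟩
      omega
    by_cases h3 : #S = 2
    · exfalso
      obtain ⟨a, ha⟩ : ∃ a, S.erase x = {a} := card_eq_one.1 (by omega)
      have haS : ∀ u ∈ S, u = x ∨ u = a := by
        intro u hu
        by_cases hux : u = x
        · exact .inl hux
        · right
          have : u ∈ S.erase x := mem_erase.2 ⟨hux, hu⟩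
          rw [ha] at this; exact mem_singleton.1 this
      have haS' : a ∈ S := by
        have : a ∈ S.erase x := by rw [ha]; simp
        exact (mem_erase.1 this).2
      refine h.r2' (D := F) (p := a) (q := f) (o := o) hF hFne (by grind) hyF (hTW o ho) (by grind)
        (by grind) (by grind) (by grind) (by grind) ?_
      intro u hu huF hv
      have := hbd u hu huF hv
      grind
    · refine ⟨by omega, adj, ?_⟩
      intro v hv
      have hvW := hFU' v hv
      obtain ⟨h4, h5⟩ := nbS v hvW.1 hvW.2.2 (hFM v hv)
      by_cases hm : ∃ m ∈ S.erase x, G.Adj m v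
      · obtain ⟨m, hm, hmv⟩ := hm
        rw [ind_of hm hmv]; omega
      · have : nb G (S ∪ T) v ⊆ {x} := by
          intro u hu
          have h6 := h5 hu
          by_contra h7
          exact hm ⟨u, by grind, (mem_nb.1 hu).2.symm⟩
        have := card_le_card this
        rw [card_singleton] at this
        omega

set_option maxHeartbeats 4000000 in
theorem Ctx.t2b {G : SimpleGraph V} {W S T : Finset V} {x y k} (h : Ctx G W x y k)
    (b : Bip G W x y S T) (hNx : ∀ u ∈ W, G.Adj x u → u ∈ T) (hNy : ∀ u ∈ W, G.Adj y u → u ∈ T)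
    (hTy : ∀ t ∈ T, G.Adj t y) : False := by
  obtain ⟨hS, hx, hy, mT, hle, hmax⟩ := b
  have hxy := h.tc.hne
  have hxW := h.tc.hx
  have hyW := h.tc.hy
  have hST : ∀ s ∈ S, ∀ t ∈ T, G.Adj s t := fun s hs t ht => ((mT t).1 ht).2 s hs
  have hTW : ∀ t ∈ T, t ∈ W := fun t ht => ((mT t).1 ht).1
  have hd : ∀ s ∈ S, s ∉ T := fun s hs ht => (hST s hs s ht).ne rfl
  have hyT : y ∉ T := fun ht => h.nadj (hST x hx y ht)
  have hxT : x ∉ T := hd x hx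
  have hcard := card_erase_of_mem hx
  have hSpos : 0 < #S := card_pos.2 ⟨x, hx⟩
  obtain ⟨t1, ht1, -, -, -, hyt1⟩ := h.two x
  obtain ⟨t2, ht2, ht12, -, -, hyt2⟩ := h.two t1
  replace ht1 := hNy t1 ht1 hyt1
  replace ht2 := hNy t2 ht2 hyt2
  have hT2 : 2 ≤ #T := one_lt_card.2 ⟨t1, ht1, t2, ht2, ht12.symm⟩
  by_cases hk : k ≤ #S
  · apply h.ng
    refine ⟨2, 2, .inr rfl, ?_⟩
    intro i hi
    have := bip_path (G := G) i hST hd hx ht1 (by omega) (by omega)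
    convert this.snoc (hTy t1 ht1) (X := W) (by grind) (union_subset hS hTW) hyW using 1; omega
  have hcT := card_erase_of_mem ht1
  obtain ⟨s1, hs1⟩ : ∃ s1, s1 = min #S (#T - 1) := ⟨_, rfl⟩
  obtain ⟨A, hA, hAc⟩ := exists_subset_card_eq (s := S.erase x) (n := s1 - 1) (by omega)
  have hAS : ∀ u ∈ A, u ∈ S ∧ u ≠ x := fun u hu => by have := hA hu; grind
  have hxA : x ∉ A := fun e => (hAS x e).2 rfl
  have hS1c : #(insert x A) = s1 := by rw [card_insert_of_notMem hxA]; omega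
  have hST1 : ∀ s ∈ insert x A, ∀ t ∈ T.erase t1, G.Adj s t := by
    intro s hs t ht
    exact hST s (by grind) t (by grind)
  have hd1 : ∀ s ∈ insert x A, s ∉ T.erase t1 := by
    intro s hs; have := hd s; grind
  have hny : ∀ v ∈ W, v ∉ T → ¬ G.Adj v y := fun v hv hvK hvy => hvK (hNy v hv hvy.symm)
  have hnx : ∀ v ∈ W, v ∉ T → ¬ G.Adj v x := fun v hv hvK hvy => hvK (hNx v hv hvy.symm)
  have tri : ∀ v ∈ W, ∀ t ∈ T, G.Adj v t → ∀ s ∈ S, ¬ G.Adj v s := by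
    intro v hv t ht hvt s hs hvs
    exact h.t3 (hTW t ht) hv (hS hs) (hST x hx t ht) hvt.symm (hST s hs t ht).symm hvs
  obtain ⟨U, hU⟩ : ∃ U, U = insert x A ∪ T.erase t1 := ⟨_, rfl⟩
  have mU : ∀ u, u ∈ U ↔ u = x ∨ u ∈ A ∨ (u ≠ t1 ∧ u ∈ T) := by
    intro u; rw [hU]; simp only [mem_union, mem_insert, mem_erase]; tauto
  have nbA : ∀ v ∈ W, v ∉ T → (∀ t ∈ T.erase t1, ¬ G.Adj t v) → nb G U v ⊆ A := by
    intro v hv hvT hvT' u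
    rw [mem_nb, mU]
    rintro ⟨h1, h2⟩
    have h3 := hvT' u
    have h4 := hnx v hv hvT
    have h5 := h2.symm
    grind
  have hyA : y ∉ A := fun e => hy (hAS y e).1
  have ht1S : t1 ∉ S := fun e => hd t1 e ht1
  have key : LAP (Pth G (W.erase y) x t1) k := by
    refine core3 (W := W.erase y) (U := U) (M := T.erase t1) (M2 := A) (L := s1)
      (L2 := s1 - 1) (N := #W) ?_ (by grind) ?_ ?_ ?_ (by grind)
      (card_pos.1 (by omega)) (by omega) ?_ ?_ h.main (card_le_card (erase_subset _ _))
      ?_ ?_ ?_ ?_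
    · intro u; rw [mU, mem_erase]
      rintro (rfl | h1 | h1)
      · exact ⟨hxy, hxW⟩
      · exact ⟨fun e => hyA (e ▸ h1), hS (hAS u h1).1⟩
      · exact ⟨fun e => hyT (e ▸ h1.2), hTW u h1.2⟩
    · exact mem_erase.2 ⟨fun e => hyT (e ▸ ht1), hTW t1 ht1⟩
    · rw [mU]
      rintro (rfl | h1 | h1)
      · exact hxT ht1
      · exact ht1S (hAS t1 h1).1
      · exact h1.1 rfl
    · intro u hu; rw [mU]; rw [mem_erase] at hu; exact .inr (.inr hu)
    · rw [hU]
      exact ⟨1, 2, .inr rfl, fun i hi m hm => bip_path i hST1 hd1 (by simp) hm (by omega) (by omega)⟩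
    · rw [hU]
      refine ⟨2, 2, .inr rfl, fun i hi m hm => ?_⟩
      exact bip_path' i hST1 hd1 (by simp) (by grind) (by grind) (by omega) (by omega)
    · intro v hv hvU hvt
      have hvU' := (mU v).not.1 hvU
      have hvW := (mem_erase.1 hv).2
      have hvT : v ∉ T := by tauto
      refine (h.deg v hvW (by tauto) (mem_erase.1 hv).1).trans (card_le_card ?_)
      intro a; simp only [mem_nb, mem_erase]
      rintro ⟨h1, h2⟩
      refine ⟨⟨?_, h1⟩, h2⟩
      rintro rfl
      exact hny v hvW hvT h2
    · intro v hv hvU hvt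
      have hvU' := (mU v).not.1 hvU
      have hvW := (mem_erase.1 hv).2
      have hvT : v ∉ T := by tauto
      by_cases hm : ∃ m ∈ T.erase t1, G.Adj m v
      · obtain ⟨m, hm, hmv⟩ := hm
        have h1 : nb G U v ⊆ T.erase t1 ∩ nb G T v := by
          intro u; simp only [mem_nb, mU, mem_inter, mem_erase]
          rintro ⟨h1, h2⟩
          have h3 := tri v hvW m (mem_erase.1 hm).2 hmv.symm u
          have := hAS u
          rcases h1 with rfl | h1 | h1
          · exact absurd h2 (h3 hx)
          · exact absurd h2 (h3 (hAS u h1).1)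
          · exact ⟨h1, h1.2, h2⟩
        have h2 := card_le_card (h1.trans inter_subset_left)
        have h3 := card_le_card (h1.trans inter_subset_right)
        rw [ind_of hm hmv]
        by_cases hvS : v ∈ S
        · have h4 : #A ≠ #S - 1 := by
            intro e
            have := eq_of_subset_of_card_le hA (by omega)
            have : v ∈ A := by rw [this]; exact mem_erase.2 ⟨by tauto, hvS⟩
            tauto
          omega
        · have h4 := hmax v hvW hvS (mem_erase.1 hv).1
          omega
      · push Not at hm
        have := card_le_card (nbA v hvW hvT hm)
        omega
    · by_contra hcon
      push Not at hcon
      have h1 : nb G W t1 ⊆ insert y (insert x A) := by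
        intro a; rw [mem_nb, mem_insert, mem_insert]
        rintro ⟨h1, h2⟩
        by_contra h3
        push Not at h3
        have h4 : a ∈ U := by
          by_contra h5
          exact hcon a (mem_erase.2 ⟨h3.1, h1⟩) h5 h2
        have h5 : a ∈ T := by
          have := (mU a).1 h4; tauto
        exact h.t1 (hTW t1 ht1) h1 (hST x hx t1 ht1) (hST x hx a h5) h2
      have h2 := card_le_card h1
      have h4 := card_insert_le y (insert x A)
      have := h.deg t1 (hTW t1 ht1) (fun e => hxT (e ▸ ht1)) (fun e => hyT (e ▸ ht1))
      omega
    · intro F f hF hFne hFU hu1F hFM hf hfU hfF hbd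
      have hFK : ∀ v ∈ F, v ∈ W ∧ v ∉ T ∧ v ≠ y ∧ v ≠ x := by
        intro v hv
        have h1 := (mU v).not.1 (hFU v hv)
        have h2 := mem_erase.1 (hF hv)
        have : v ≠ t1 := fun e => hu1F (e ▸ hv)
        tauto
      have nbF : ∀ v ∈ F, nb G U v ⊆ A := fun v hv =>
        nbA v (hFK v hv).1 (hFK v hv).2.1 (hFM v hv)
      have adj : ∃ v ∈ F, ∃ m ∈ A, G.Adj m v := by
        obtain ⟨u, hu, huQ, huf, v, hv, hvu⟩ := h.tc.h F (fun v hv => (hFK v hv).1) hFne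
          (fun e => (hFK x e).2.2.2 rfl) (fun e => (hFK y e).2.2.1 rfl) f
        have h1 := hFK v hv
        have h4 := hny v h1.1 h1.2.1
        have huy : u ≠ y := fun e => h4 (e ▸ hvu)
        have h2 := hbd u (mem_erase.2 ⟨huy, hu⟩) huQ ⟨v, hv, hvu⟩
        have h3 := h2.resolve_left huf
        exact ⟨v, hv, u, nbF v hv (mem_nb.2 ⟨h3.1, hvu⟩), hvu.symm⟩
      have h2 : 0 < #A := by
        obtain ⟨_, _, m, hm, _⟩ := adj
        exact card_pos.2 ⟨m, hm⟩
      refine ⟨by omega, adj, ?_⟩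
      intro v hv
      have h3 := nbF v hv
      have h4 := card_le_card h3
      by_cases hm : ∃ m ∈ A, G.Adj m v
      · obtain ⟨m, hm, hmv⟩ := hm
        rw [ind_of hm hmv]; omega
      · have : nb G U v = ∅ := by
          rw [eq_empty_iff_forall_notMem]
          intro a ha
          exact hm ⟨a, h3 ha, (mem_nb.1 ha).2.symm⟩
        rw [this, card_empty]; omega
  apply h.ng
  refine key.mono le_rfl 1 (fun n hn => hn.snoc (hTy t1 ht1) (by simp) (erase_subset _ _) hyW)

theorem Ctx.alt {G : SimpleGraph V} {W S T : Finset V} {x y k} (h : Ctx G W x y k)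
    (b : Bip G W x y S T) : (∀ u ∈ W, G.Adj y u → u ∈ T) ∨ (∀ u ∈ W, G.Adj y u → u ∈ S.erase x) := by
  have key := h.t2a b
  by_contra hcon
  push Not at hcon
  obtain ⟨⟨u, hu, hyu, huT⟩, ⟨v, hv, hyv, hvS⟩⟩ := hcon
  have h1 := mem_union.1 (key u hu hyu)
  have h2 := mem_union.1 (key v hv hyv)
  have hvx : v ≠ x := fun e => h.nadj (e ▸ hyv.symm)
  have huS : u ∈ S := h1.resolve_right huT
  have hvT : v ∈ T := h2.resolve_left (fun e => hvS (mem_erase.2 ⟨hvx, e⟩))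
  exact h.symm.t1 hu hv hyu hyv (((b.mT v).1 hvT).2 u huS)

theorem Ctx.aux {G : SimpleGraph V} {W S T S' T' : Finset V} {x y k} (h : Ctx G W x y k)
    (b : Bip G W x y S T) (b' : Bip G W y x S' T') : ∀ u ∈ W, G.Adj y u → u ∈ T := by
  refine (h.alt b).resolve_right (fun hy => ?_)
  have t1 : T ⊆ nb G W x := fun t ht => mem_nb.2 ⟨((b.mT t).1 ht).1, ((b.mT t).1 ht).2 x b.hx⟩
  have t2 : T' ⊆ nb G W y := fun t ht => mem_nb.2 ⟨((b'.mT t).1 ht).1, ((b'.mT t).1 ht).2 y b'.hx⟩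
  have t3 : nb G W y ⊆ S.erase x := fun u hu => hy u (mem_nb.1 hu).1 (mem_nb.1 hu).2
  have c1 := card_le_card t1
  have c2 := card_le_card t2
  have c3 := card_le_card t3
  rw [card_erase_of_mem b.hx] at c3
  have p1 := card_pos.2 ⟨x, b.hx⟩
  have p2 := card_pos.2 ⟨y, b'.hx⟩
  have l1 := b.hle
  have l2 := b'.hle
  rcases h.symm.alt b' with hx | hx
  · have t4 : nb G W x ⊆ T' := fun u hu => hx u (mem_nb.1 hu).1 (mem_nb.1 hu).2
    have := card_le_card t4
    omega
  · have t4 : nb G W x ⊆ S'.erase y := fun u hu => hx u (mem_nb.1 hu).1 (mem_nb.1 hu).2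
    have := card_le_card t4
    rw [card_erase_of_mem b'.hx] at this
    omega

theorem Ctx.false {G : SimpleGraph V} {W : Finset V} {x y k} (h : Ctx G W x y k) : False := by
  obtain ⟨S, T, b⟩ := h.exBip
  obtain ⟨S', T', b'⟩ := h.symm.exBip
  have hy := h.aux b b'
  have hx := h.symm.aux b' b
  have t1 : ∀ t ∈ T, t ∈ W ∧ G.Adj x t := fun t ht => ⟨((b.mT t).1 ht).1, ((b.mT t).1 ht).2 x b.hx⟩
  have t2 : ∀ t ∈ T', t ∈ W ∧ G.Adj y t := fun t ht => ⟨((b'.mT t).1 ht).1, ((b'.mT t).1 ht).2 y b'.hx⟩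
  refine h.t2b b ?_ hy ?_
  · intro u hu hxu
    have := t2 u (hx u hu hxu)
    exact hy u hu this.2
  · intro t ht
    have := t1 t ht
    exact (t2 t (hx t this.1 this.2)).2.symm

end
end Adm

namespace Adm
noncomputable section
open Classical Finset
variable {V : Type*}

theorem mainFor (V : Type*) : ∀ N, MainFor V N := by
  intro N
  induction N with
  | zero => intro W hW; omega
  | succ N ih =>
  intro W hW G x y k htc hdeg
  have hm : MainFor V #W := fun W' hW' => ih W' (by omega)
  suffices H : LAP (Pth (del G x y) W x y) k from H.mono le_rfl 0 (fun n hn => hn.of_del)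
  have hdeg' : ∀ v ∈ W, v ≠ x → v ≠ y → k + 1 ≤ #(nb (del G x y) W v) := by
    intro v hv h1 h2
    rw [nb_del h1 h2]; exact hdeg v hv h1 h2
  have htc' := htc.del
  by_cases hk : 3 ≤ k
  · by_contra hng
    exact Ctx.false ⟨hm, htc', not_del _ _ _, hdeg', hk, hng⟩
  · have : k = 0 ∨ k = 1 ∨ k = 2 := by omega
    rcases this with rfl | rfl | rfl
    · exact ⟨0, 1, .inl rfl, by simp⟩
    · obtain ⟨n, hn⟩ := htc'.path
      refine ⟨n, 1, .inl rfl, fun i hi => ?_⟩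
      have : i = 0 := by omega
      subst this; simpa using hn
    · obtain ⟨v, hv, h1, h2⟩ := htc.hex
      exact lemma2 _ W rfl _ x y x htc' ⟨v, hv, h1, h2, h1⟩ (fun v hv h1 h2 _ => hdeg' v hv h1 h2)

theorem Pth.walk {G : SimpleGraph V} {W a b n} (h : Pth G W a b n) :
    ∃ P : G.Walk a b, P.IsPath ∧ P.length = n ∧ ∀ u ∈ P.support, u ∈ W := by
  induction h with
  | nil h => exact ⟨.nil, by simp, by simp, by simpa using h⟩
  | @cons W a b c n h1 h2 h3 ih =>
    obtain ⟨P, hP, hl, hs⟩ := ih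
    refine ⟨.cons h2 P, ?_, by simp [hl], ?_⟩
    · rw [SimpleGraph.Walk.cons_isPath_iff]
      exact ⟨hP, fun ha => (mem_erase.1 (hs a ha)).1 rfl⟩
    · intro u hu
      rw [SimpleGraph.Walk.support_cons, List.mem_cons] at hu
      rcases hu with rfl | hu
      · exact h1
      · exact (mem_erase.1 (hs u hu)).2

theorem tc_of [Fintype V] {G : SimpleGraph V} {x y : V} (hxy : x ≠ y)
    (h2 : TwoConnected (G ⊔ SimpleGraph.fromEdgeSet {s(x, y)})) : TC G univ x y := by
  refine ⟨mem_univ _, mem_univ _, hxy, ?_, ?_⟩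
  · by_contra hcon
    push Not at hcon
    have : (univ : Finset V) ⊆ {x, y} := by
      intro v hv; have := hcon v hv; simp; tauto
    have h3 := (card_le_card this).trans card_le_two
    have := h2.1
    rw [card_univ] at h3
    omega
  · intro D _ hne hx hy p
    have key : ∀ p, p ∉ D → ∃ u, u ∉ D ∧ u ≠ p ∧ ∃ v ∈ D, G.Adj v u := by
      intro p hp
      obtain ⟨d, hd⟩ := hne
      obtain ⟨e, heD, hep⟩ : ∃ e, e ∉ D ∧ e ≠ p := by
        by_cases h : x = p
        · exact ⟨y, hy, fun e => hxy (h.trans e.symm)⟩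
        · exact ⟨x, hx, h⟩
      have hdp : d ≠ p := fun e => hp (e ▸ hd)
      obtain ⟨w⟩ := (h2.2 p).preconnected ⟨d, by simpa using hdp⟩ ⟨e, by simpa using hep⟩
      obtain ⟨a, -, ha1, ha2⟩ := w.exists_boundary_dart {u | u.1 ∈ D} hd heD
      have ha := a.adj
      simp only [Set.mem_setOf_eq] at ha1 ha2
      refine ⟨a.snd.1, ha2, a.snd.2, a.fst.1, ha1, ?_⟩
      rw [SimpleGraph.comap_adj, SimpleGraph.sup_adj, SimpleGraph.fromEdgeSet_adj] at ha
      rcases ha with ha | ha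
      · exact ha
      · exfalso
        have := ha.1
        simp only [Set.mem_singleton_iff, Function.Embedding.subtype_apply, Sym2.eq_iff] at this
        rcases this with ⟨h, _⟩ | ⟨h, _⟩
        · exact hx (h ▸ ha1)
        · exact hy (h ▸ ha1)
    by_cases hp : p ∈ D
    · obtain ⟨u, h1, _, h3⟩ := key x hx
      exact ⟨u, mem_univ _, h1, fun e => h1 (e ▸ hp), h3⟩
    · obtain ⟨u, h1, h4, h3⟩ := key p hp
      exact ⟨u, mem_univ _, h1, h4, h3⟩

theorem final [Fintype V] (k : ℕ) (hk : 1 ≤ k)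
    (G : SimpleGraph V) [DecidableRel G.Adj] (x y : V) (hxy : x ≠ y)
    (h2 : TwoConnected (G ⊔ SimpleGraph.fromEdgeSet {s(x, y)}))
    (hdeg : ∀ v : V, v ≠ x → v ≠ y → k + 1 ≤ G.degree v) :
    ∃ ℓ d : ℕ, 2 ≤ ℓ ∧ (d = 1 ∨ d = 2) ∧
      ∀ i < k, ∃ P : G.Walk x y, P.IsPath ∧ P.length = ℓ + d * i := by
  have htc := (tc_of hxy h2).del
  obtain ⟨l, d, hd, hl⟩ := mainFor V _ univ (Nat.lt_succ_self _) (del G x y) x y k htc (by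
    intro v _ h1 h3
    rw [nb_del h1 h3]
    refine (hdeg v h1 h3).trans (le_of_eq ?_)
    rw [← SimpleGraph.card_neighborFinset_eq_degree]
    congr 1
    ext u
    simp [mem_nb])
  refine ⟨l, d, ?_, hd, fun i hi => ?_⟩
  · have h0 := hl 0 (by omega)
    by_contra hcon
    have : l + d * 0 = 0 ∨ l + d * 0 = 1 := by omega
    rcases this with h | h
    · rw [h] at h0
      cases h0
      exact hxy rfl
    · rw [h] at h0
      cases h0 with
      | cons a b c =>
        cases c
        exact not_del _ _ _ b
  · obtain ⟨P, h1, h3, _⟩ := ((hl i hi).of_del).walk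
    exact ⟨P, h1, h3⟩

end
end Adm

/-- Theorem 3.1 of [GHLM]: if `(G, x, y)` is a 2-connected rooted graph of minimum degree at
least `k + 1`, then there exist `k` admissible paths between `x` and `y` in `G`, i.e. `k` paths
whose lengths form an arithmetic progression with common difference one or two starting at a
length at least 2. -/
theorem stmt_5 {V : Type*} [Fintype V] (k : ℕ) (hk : 1 ≤ k)
    (G : SimpleGraph V) [DecidableRel G.Adj] (x y : V) (hxy : x ≠ y)
    (h2 : TwoConnected (G ⊔ SimpleGraph.fromEdgeSet {s(x, y)}))
    (hdeg : ∀ v : V, v ≠ x → v ≠ y → k + 1 ≤ G.degree v) :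
    ∃ ℓ d : ℕ, 2 ≤ ℓ ∧ (d = 1 ∨ d = 2) ∧
      ∀ i < k, ∃ P : G.Walk x y, P.IsPath ∧ P.length = ℓ + d * i := by
  exact Adm.final k hk G x y hxy h2 hdeg
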